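/- arXiv:2108.02873 — 11 statements merged into one kernel-verified Lean document; each statement's English description precedes it below -/
import Mathlib

section
/- Let n be a positive integer and let M = (m_{i,j}) be a symmetric n×n matrix over GF(2) with zero diagonal. Then the STZ condition holds for M if and only if at least one of the following holds: (1) M² = M (equivalently, for all i,j and α ∈ {0,1}, m_{i,j} = α implies ⟨m_i,m_j⟩ = α); or (2) there exists a proper subset K ⊊ {1,…,n} such that M + M² = Σ_{k∈K} M_k, where M_k denotes the matrix obtained from M by zeroing all entries except those in the k-th row and the k-th column. -/
theorem sum_rowcol_aux {n : ℕ} (M : Matrix (Fin n) (Fin n) (ZMod 2)) (hdiag : ∀ i, M i i = 0)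
    (K : Finset (Fin n)) (i j : Fin n) :
    (∑ k ∈ K, Matrix.of (fun i j => if i = k ∨ j = k then M i j else 0)) i j
      = M i j * ((if i ∈ K then 1 else 0) + (if j ∈ K then 1 else 0)) := by
  rw [Matrix.sum_apply]
  by_cases hij : i = j
  · subst hij
    simp [hdiag]
  · have h : ∀ k ∈ K, (Matrix.of (fun i j => if i = k ∨ j = k then M i j else 0)) i j
        = (if i = k then M i j else 0) + (if j = k then M i j else 0) := by
      intro k _
      rw [Matrix.of_apply]
      by_cases h1 : i = k
      · have h2 : j ≠ k := fun h => hij (h1.trans h.symm)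
        simp [h1, h2]
      · simp [h1]
    rw [Finset.sum_congr rfl h, Finset.sum_add_distrib, Finset.sum_ite_eq, Finset.sum_ite_eq,
      mul_add, mul_ite, mul_ite, mul_one, mul_zero]

theorem stz_aux {n : ℕ} (M : Matrix (Fin n) (Fin n) (ZMod 2)) (d : Fin n → ZMod 2) :
    (M + Matrix.diagonal d) * (M + Matrix.diagonal d) = M + Matrix.diagonal d ↔
      ∀ i j, (M + M * M) i j = M i j * (d i + d j) := by
  have hd : ∀ a : ZMod 2, a * a = a := by decide
  have h2 : ∀ a : ZMod 2, a + a = 0 := by decide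
  have key : ∀ a b c e f : ZMod 2, (b + e * a + (a * f + c) = a + c ↔ a + b = a * (e + f)) := by
    decide
  have hexp : (M + Matrix.diagonal d) * (M + Matrix.diagonal d) =
      M * M + Matrix.diagonal d * M + (M * Matrix.diagonal d + Matrix.diagonal d) := by
    rw [mul_add, add_mul, add_mul, Matrix.diagonal_mul_diagonal]
    simp only [hd]
  rw [hexp, ← Matrix.ext_iff]
  refine forall_congr' fun i => forall_congr' fun j => ?_
  simp only [Matrix.add_apply, Matrix.diagonal_mul, Matrix.mul_diagonal]
  exact key _ _ _ _ _

/-- For a symmetric `n × n` matrix `M` over `GF(2)` with zero diagonal,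
the STZ condition holds iff `M² = M`, or there is a proper subset `K ⊊ {1,…,n}` with
`M + M² = ∑_{k ∈ K} M_k`, where `M_k` is obtained from `M` by zeroing every entry
outside the `k`-th row and `k`-th column. -/
theorem stz_iff_idempotent_or_sum_rowcol (n : ℕ) (hn : 0 < n)
    (M : Matrix (Fin n) (Fin n) (ZMod 2)) (hsymm : M.IsSymm) (hdiag : ∀ i, M i i = 0) :
    (∃ d : Fin n → ZMod 2,
        (M + Matrix.diagonal d) * (M + Matrix.diagonal d) = M + Matrix.diagonal d) ↔
      (M * M = M ∨
        ∃ K : Finset (Fin n), K ⊂ Finset.univ ∧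
          M + M * M =
            ∑ k ∈ K, Matrix.of (fun i j => if i = k ∨ j = k then M i j else 0)) := by
  have h2 : ∀ a : ZMod 2, a + a = 0 := by decide
  constructor
  · rintro ⟨d, hd⟩
    rw [stz_aux] at hd
    have hK : M + M * M = ∑ k ∈ Finset.univ.filter (fun i => d i = 1),
        Matrix.of (fun i j => if i = k ∨ j = k then M i j else 0) := by
      ext i j
      rw [hd, sum_rowcol_aux M hdiag]
      have h01 : ∀ a : ZMod 2, (if a = 1 then (1 : ZMod 2) else 0) = a := by decide
      simp [h01]
    by_cases hu : Finset.univ.filter (fun i => d i = 1) = Finset.univ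
    · left
      ext i j
      have h1 : ∀ i, d i = 1 := by simpa [Finset.filter_eq_self] using hu
      have h := hd i j
      have key : ∀ a b : ZMod 2, a + b = a * (1 + 1) → b = a := by decide
      rw [h1, h1, Matrix.add_apply] at h
      exact key _ _ h
    · right
      exact ⟨_, (Finset.subset_univ _).ssubset_of_ne hu, hK⟩
  · rintro (h | ⟨K, -, hK⟩)
    · exact ⟨0, by simpa using h⟩
    · refine ⟨fun i => if i ∈ K then 1 else 0, ?_⟩
      rw [stz_aux]
      intro i j
      rw [hK, sum_rowcol_aux M hdiag]
end

section
/- Let M = (m_{i,j}) be a symmetric n×n matrix over GF(2) with zero diagonal satisfying: for all i,j, if m_{i,j} = 0 then ⟨m_i,m_j⟩ = 0 (this encodes conditions PC1 and PC2). Then the STZ condition holds for M if and only if the system of equations α_i + α_j = ⟨m_i,m_j⟩ + 1, ranging over all pairs (i,j) with m_{i,j} = 1, has a solution α_1,…,α_n over GF(2). -/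
/-- Let `M` be a symmetric `n × n` matrix over `GF(2)` with zero diagonal
satisfying: `m_{i,j} = 0` implies `⟨m_i, m_j⟩ = 0` (conditions PC1 and PC2). Then the STZ
condition holds for `M` iff the system `α_i + α_j = ⟨m_i, m_j⟩ + 1`, over all pairs `(i,j)`
with `m_{i,j} = 1`, has a solution over `GF(2)`. -/
theorem stz_iff_system_on_edges (n : ℕ)
    (M : Matrix (Fin n) (Fin n) (ZMod 2)) (hsymm : M.IsSymm) (hdiag : ∀ i, M i i = 0)
    (hpc : ∀ i j : Fin n, M i j = 0 → (M * M) i j = 0) :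
    (∃ d : Fin n → ZMod 2,
        (M + Matrix.diagonal d) * (M + Matrix.diagonal d) = M + Matrix.diagonal d) ↔
      (∃ α : Fin n → ZMod 2, ∀ i j : Fin n,
        M i j = 1 → α i + α j = (M * M) i j + 1) := by
  have key : ∀ (d : Fin n → ZMod 2) (i j : Fin n),
      ((M + Matrix.diagonal d) * (M + Matrix.diagonal d)) i j
        = (M * M) i j + M i j * d j + d i * M i j + (if i = j then d i * d i else 0) := by
    intro d i j
    rw [add_mul, mul_add, mul_add, Matrix.diagonal_mul_diagonal]
    simp only [Matrix.add_apply, Matrix.mul_diagonal, Matrix.diagonal_mul,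
      Matrix.diagonal_apply]
    ring
  constructor
  · rintro ⟨d, hd⟩
    refine ⟨d, fun i j hij => ?_⟩
    have hne : i ≠ j := by
      rintro rfl
      rw [hdiag] at hij
      exact absurd hij (by decide)
    have h := key d i j
    rw [hd] at h
    simp only [Matrix.add_apply, Matrix.diagonal_apply, if_neg hne, hij] at h
    generalize (M * M) i j = x at *
    generalize d i = a at *
    generalize d j = b at *
    revert h
    revert x a b
    decide
  · rintro ⟨d, hd⟩
    refine ⟨d, ?_⟩
    ext i j
    rw [key]
    simp only [Matrix.add_apply, Matrix.diagonal_apply]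
    by_cases hij : i = j
    · subst hij
      rw [hpc i i (hdiag i), hdiag]
      generalize d i = a
      simp only [if_true]
      revert a
      decide
    · simp only [if_neg hij]
      have h0 := hpc i j
      have h1 := hd i j
      generalize (M * M) i j = x at *
      generalize M i j = m at *
      generalize d i = a at *
      generalize d j = b at *
      clear hd key
      revert x m a b
      decide
end

section
/- Let M = (m_{i,j}) be a symmetric n×n matrix over GF(2) with zero diagonal. Then the STZ condition holds for M if and only if both of the following hold: (a) for all i,j, if m_{i,j} = 0 then ⟨m_i,m_j⟩ = 0; and (b) there exists a 2-colouring α : {1,…,n} → GF(2) such that for every pair i,j with m_{i,j} = 1: if ⟨m_i,m_j⟩ = 1 then α_i = α_j, and if ⟨m_i,m_j⟩ = 0 then α_i ≠ α_j. -/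
/-- For a symmetric `n × n` matrix `M` over `GF(2)` with zero diagonal,
the STZ condition holds iff (a) `m_{i,j} = 0` implies `⟨m_i, m_j⟩ = 0`, and (b) there is a
2-colouring `α : {1,…,n} → GF(2)` such that whenever `m_{i,j} = 1`: if `⟨m_i, m_j⟩ = 1`
then `α_i = α_j`, and if `⟨m_i, m_j⟩ = 0` then `α_i ≠ α_j`. -/
theorem stz_iff_two_colouring (n : ℕ)
    (M : Matrix (Fin n) (Fin n) (ZMod 2)) (hsymm : M.IsSymm) (hdiag : ∀ i, M i i = 0) :
    (∃ d : Fin n → ZMod 2,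
        (M + Matrix.diagonal d) * (M + Matrix.diagonal d) = M + Matrix.diagonal d) ↔
      ((∀ i j : Fin n, M i j = 0 → (M * M) i j = 0) ∧
        ∃ α : Fin n → ZMod 2, ∀ i j : Fin n, M i j = 1 →
          ((M * M) i j = 1 → α i = α j) ∧ ((M * M) i j = 0 → α i ≠ α j)) := by
  have key : ∀ d : Fin n → ZMod 2, ∀ i j : Fin n,
      (((M + Matrix.diagonal d) * (M + Matrix.diagonal d)) i j = (M + Matrix.diagonal d) i j ↔
        (M * M) i j + M i j * (d i + d j) = M i j) := by
    intro d i j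
    rw [add_mul, mul_add, mul_add, Matrix.diagonal_mul_diagonal]
    simp only [Matrix.add_apply, Matrix.mul_diagonal, Matrix.diagonal_mul]
    by_cases h : i = j
    · subst h
      rw [Matrix.diagonal_apply_eq, Matrix.diagonal_apply_eq, hdiag i]
      generalize (M * M) i i = x
      generalize d i = y
      revert x y
      decide
    · rw [Matrix.diagonal_apply_ne _ h, Matrix.diagonal_apply_ne _ h]
      generalize (M * M) i j = x
      generalize d i = y
      generalize d j = z
      generalize M i j = w
      revert x y z w
      decide
  have fwd : ∀ x w y z : ZMod 2, x + w * (y + z) = w →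
      (w = 0 → x = 0) ∧ (w = 1 → (x = 1 → y = z) ∧ (x = 0 → y ≠ z)) := by decide
  have bwd : ∀ x w y z : ZMod 2, (w = 0 → x = 0) →
      (w = 1 → (x = 1 → y = z) ∧ (x = 0 → y ≠ z)) → x + w * (y + z) = w := by decide
  constructor
  · rintro ⟨d, hd⟩
    have h : ∀ i j, (M * M) i j + M i j * (d i + d j) = M i j := fun i j =>
      (key d i j).1 (by rw [hd])
    exact ⟨fun i j => (fwd _ _ _ _ (h i j)).1, d, fun i j => (fwd _ _ _ _ (h i j)).2⟩
  · rintro ⟨ha, d, hd⟩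
    refine ⟨d, ?_⟩
    ext i j
    exact (key d i j).2 (bwd _ _ _ _ (ha i j) (hd i j))
end

section
/- Let G be a finite simple graph on vertex set V with adjacency matrix M over GF(2). Then there exists a diagonal matrix Λ over GF(2) such that (M+Λ)² = M+Λ if and only if the following two (Rosenstiehl) conditions hold: (i) every vertex of G has even degree; and (ii) there exists a subset A ⊆ V such that for all distinct vertices u, v, the following are equivalent: u and v have an odd number of common neighbours; u and v are adjacent and either both belong to A or neither does. -/
theorem stz_sq_entry {V : Type*} [Fintype V] [DecidableEq V]
    (G : SimpleGraph V) [DecidableRel G.Adj] (u v : V) :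
    (G.adjMatrix (ZMod 2) * G.adjMatrix (ZMod 2)) u v
      = ((G.neighborFinset u ∩ G.neighborFinset v).card : ZMod 2) := by
  rw [SimpleGraph.adjMatrix_mul_apply]
  simp only [SimpleGraph.adjMatrix_apply]
  rw [Finset.sum_boole]
  congr 2
  ext w
  simp [G.adj_comm]

theorem stz_expand {V : Type*} [Fintype V] [DecidableEq V]
    (G : SimpleGraph V) [DecidableRel G.Adj] (d : V → ZMod 2) (u v : V) :
    ((G.adjMatrix (ZMod 2) + Matrix.diagonal d) *
      (G.adjMatrix (ZMod 2) + Matrix.diagonal d)) u v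
      = ((G.neighborFinset u ∩ G.neighborFinset v).card : ZMod 2)
        + d u * (if G.Adj u v then 1 else 0) + (if G.Adj u v then 1 else 0) * d v
        + (if u = v then d u * d u else 0) := by
  rw [add_mul, mul_add, mul_add, Matrix.add_apply, Matrix.add_apply, Matrix.add_apply,
    stz_sq_entry, Matrix.mul_diagonal, Matrix.diagonal_mul, Matrix.diagonal_mul_diagonal,
    Matrix.diagonal_apply, SimpleGraph.adjMatrix_apply]
  ring

theorem stz_entry_diag {V : Type*} [Fintype V] [DecidableEq V]
    (G : SimpleGraph V) [DecidableRel G.Adj] (d : V → ZMod 2) (v : V) :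
    ((G.adjMatrix (ZMod 2) + Matrix.diagonal d) *
      (G.adjMatrix (ZMod 2) + Matrix.diagonal d)) v v
      = (G.adjMatrix (ZMod 2) + Matrix.diagonal d) v v ↔ Even (G.degree v) := by
  rw [stz_expand, ← ZMod.natCast_eq_zero_iff_even]
  have h : ∀ c x : ZMod 2, c + x * x = x ↔ c = 0 := by decide
  simpa using h (G.degree v) (d v)

theorem stz_entry_off {V : Type*} [Fintype V] [DecidableEq V]
    (G : SimpleGraph V) [DecidableRel G.Adj] (d : V → ZMod 2) (u v : V) (huv : u ≠ v) :
    ((G.adjMatrix (ZMod 2) + Matrix.diagonal d) *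
      (G.adjMatrix (ZMod 2) + Matrix.diagonal d)) u v
      = (G.adjMatrix (ZMod 2) + Matrix.diagonal d) u v ↔
      (Odd ((G.neighborFinset u ∩ G.neighborFinset v).card) ↔
        (G.Adj u v ∧ (d u = 1 ↔ d v = 1))) := by
  rw [stz_expand, ← ZMod.natCast_eq_one_iff_odd, Matrix.add_apply,
    Matrix.diagonal_apply_ne _ huv, SimpleGraph.adjMatrix_apply, if_neg huv]
  generalize ((G.neighborFinset u ∩ G.neighborFinset v).card : ZMod 2) = c
  generalize d u = x
  generalize d v = y
  by_cases h : G.Adj u v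
  · simp only [h, if_true, true_and]
    revert c x y
    decide
  · simp only [h, if_false, false_and]
    revert c x y
    decide

/-- For a finite simple graph `G` with adjacency matrix `M` over `GF(2)`,
there is a diagonal matrix `Λ` with `(M+Λ)² = M+Λ` iff (i) every vertex has even degree, and
(ii) there is a set `A` of vertices such that for all distinct `u, v`: `u` and `v` have an
odd number of common neighbours iff `u` and `v` are adjacent and (`u ∈ A ↔ v ∈ A`). -/
theorem stz_iff_rosenstiehl {V : Type*} [Fintype V] [DecidableEq V]
    (G : SimpleGraph V) [DecidableRel G.Adj] :
    (∃ d : V → ZMod 2,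
        (G.adjMatrix (ZMod 2) + Matrix.diagonal d) *
            (G.adjMatrix (ZMod 2) + Matrix.diagonal d)
          = G.adjMatrix (ZMod 2) + Matrix.diagonal d) ↔
      ((∀ v : V, Even (G.degree v)) ∧
        ∃ A : Set V, ∀ u v : V, u ≠ v →
          (Odd ((G.neighborFinset u ∩ G.neighborFinset v).card) ↔
            (G.Adj u v ∧ (u ∈ A ↔ v ∈ A)))) := by
  constructor
  · rintro ⟨d, h⟩
    refine ⟨fun v => (stz_entry_diag G d v).1 (by rw [h]), {v | d v = 1}, fun u v huv => ?_⟩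
    exact (stz_entry_off G d u v huv).1 (by rw [h])
  · rintro ⟨h1, A, h2⟩
    classical
    refine ⟨fun v => if v ∈ A then 1 else 0, ?_⟩
    ext u v
    by_cases huv : u = v
    · subst huv
      exact (stz_entry_diag G _ u).2 (h1 u)
    · refine (stz_entry_off G _ u v huv).2 ?_
      simpa using h2 u v huv
end

section
/- Let n ≥ 2 and let f be a chord diagram of size n (a fixed-point-free involution of ZMod (2n)) whose interlacement graph is connected (i.e. f is prime). Then f has at least one ×-arc: there exists i ∈ ZMod (2n) such that f i ≠ i+1 and the chord through i and the chord through i+1 interlace. -/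
/-- `b` lies strictly between `a` and `c` in the cyclic order of `ZMod m`
(on the arc going from `a` towards `c` in the positive direction). -/
def StrictlyBetween {m : ℕ} (a c b : ZMod m) : Prop :=
  0 < (b - a).val ∧ (b - a).val < (c - a).val

/-- The chord through `a` and the chord through `b` (chords `{a, f a}` and `{b, f b}` of the
chord diagram `f`) interlace: exactly one of `b`, `f b` lies strictly between `a` and `f a`
in the cyclic order. -/
def Interlace {m : ℕ} (f : ZMod m → ZMod m) (a b : ZMod m) : Prop :=
  (StrictlyBetween a (f a) b ∧ ¬ StrictlyBetween a (f a) (f b)) ∨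
    (¬ StrictlyBetween a (f a) b ∧ StrictlyBetween a (f a) (f b))

/-- The interlacement graph of a chord diagram `f`: two points are adjacent iff the chords
through them interlace (so its connected components correspond to those of the interlacement
graph on chords). -/
def interlacementGraph {m : ℕ} (f : ZMod m → ZMod m) : SimpleGraph (ZMod m) :=
  SimpleGraph.fromRel (Interlace f)

/-- Adding one raises `val` by one unless we wrap around to zero. -/
lemma val_succ_of_ne {m : ℕ} (hm : 2 ≤ m) (x : ZMod m) (hx : x + 1 ≠ 0) :
    (x + 1).val = x.val + 1 := by
  have : NeZero m := ⟨by omega⟩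
  have : Fact (1 < m) := ⟨by omega⟩
  have h1 : (1 : ZMod m).val = 1 := ZMod.val_one m
  have hlt := ZMod.val_lt x
  by_cases h : x.val + 1 < m
  · rw [ZMod.val_add_of_lt (by rw [h1]; exact h), h1]
  · exfalso
    apply hx
    have he : x.val + 1 = m := by omega
    have h2 : ((x.val + 1 : ℕ) : ZMod m) = 0 := by rw [he]; simp
    simpa using h2

/-- A prime chord diagram has a cross arc. -/
theorem prime_has_cross_arc (n : ℕ) (hn : 2 ≤ n)
    (f : ZMod (2 * n) → ZMod (2 * n))
    (hinv : Function.Involutive f) (hfpf : ∀ i, f i ≠ i)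
    (hprime : (interlacementGraph f).Connected) :
    ∃ i : ZMod (2 * n), f i ≠ i + 1 ∧ Interlace f i (i + 1) := by
  have : NeZero (2 * n) := ⟨by omega⟩
  have : Fact (1 < 2 * n) := ⟨by omega⟩
  have hm : 2 ≤ 2 * n := by omega
  have h1 : (1 : ZMod (2 * n)).val = 1 := ZMod.val_one _
  have hval : ∀ x : ZMod (2 * n), x.val = 0 ↔ x = 0 := fun x => ZMod.val_eq_zero x
  have hinj : ∀ x y : ZMod (2 * n), x.val = y.val → x = y :=
    fun x y h => ZMod.val_injective _ h
  by_contra hno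
  push Not at hno
  obtain ⟨i, hi⟩ := Finite.exists_min (fun i => (f i - i).val)
  -- the minimal chord has length one
  have hfi : f i = i + 1 := by
    by_contra hne
    have hI := hno i hne
    have hpos : (f i - i).val ≠ 0 := by
      rw [Ne, hval, sub_eq_zero]; exact hfpf i
    have hne1 : (f i - i).val ≠ 1 := by
      intro h
      apply hne
      have := hinj _ _ (h.trans h1.symm)
      linear_combination this
    have hb1 : StrictlyBetween i (f i) (i + 1) := by
      unfold StrictlyBetween
      rw [add_sub_cancel_left, h1]
      omega
    have hb2 : StrictlyBetween i (f i) (f (i + 1)) := by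
      by_contra h
      exact hI (Or.inl ⟨hb1, h⟩)
    obtain ⟨hp, hl⟩ := hb2
    have he : f (i + 1) - i = (f (i + 1) - (i + 1)) + 1 := by ring
    have hv := val_succ_of_ne hm (f (i + 1) - (i + 1)) (by
      rw [← he]
      intro h
      rw [h] at hp
      simp at hp)
    rw [← he] at hv
    have := hi (i + 1)
    omega
  -- hence it is isolated
  have : Nontrivial (ZMod (2 * n)) := inferInstance
  obtain ⟨b, hb⟩ := hprime.preconnected.exists_adj_of_nontrivial i
  have hfi' : f (i + 1) = i := by rw [← hfi, hinv]
  rw [interlacementGraph, SimpleGraph.fromRel_adj] at hb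
  obtain ⟨hib, h | h⟩ := hb
  · have hnone : ∀ c, ¬ StrictlyBetween i (f i) c := by
      intro c hc
      unfold StrictlyBetween at hc
      rw [hfi, add_sub_cancel_left, h1] at hc
      omega
    rcases h with h | h
    · exact hnone _ h.1
    · exact hnone _ h.2
  · unfold Interlace StrictlyBetween at h
    rw [hfi] at h
    by_cases hb1 : b = i + 1
    · subst hb1
      rw [hfi'] at h
      simp at h
    · have he : i + 1 - b = (i - b) + 1 := by ring
      have hv := val_succ_of_ne hm (i - b) (by
        rw [← he, sub_ne_zero]; exact fun h => hb1 h.symm)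
      rw [← he] at hv
      have hx : (i - b).val ≠ 0 := by
        rw [Ne, hval, sub_eq_zero]; exact hib
      have hy : (f b - b).val ≠ (i + 1 - b).val := by
        intro hh
        have h2 : f b = i + 1 := by
          have := hinj _ _ hh
          linear_combination this
        apply hib
        rw [← hfi', ← h2, hinv]
      omega
end

section
/- Let n ≥ 2 and let f be a chord diagram of size n (a fixed-point-free involution of ZMod (2n)). Then every arc of f is a ×-arc (i.e. for every i ∈ ZMod (2n), f i ≠ i+1 and the chords through i and i+1 interlace) if and only if f is the wheel diagram of size n, i.e. f i = i + n for all i ∈ ZMod (2n). -/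
/-- For a chord diagram of size `n ≥ 2` (a fixed-point-free involution `f` of
`ZMod (2n)`), every arc is a `×`-arc (for every `i`, `f i ≠ i + 1` and the chords through `i`
and `i + 1` interlace) iff `f` is the wheel diagram of size `n`, i.e. `f i = i + n` for all
`i`. -/
theorem all_cross_arcs_iff_wheel (n : ℕ) (hn : 2 ≤ n)
    (f : ZMod (2 * n) → ZMod (2 * n))
    (hinv : Function.Involutive f) (hfpf : ∀ i, f i ≠ i) :
    (∀ i : ZMod (2 * n), f i ≠ i + 1 ∧ Interlace f i (i + 1)) ↔
      (∀ i : ZMod (2 * n), f i = i + (n : ZMod (2 * n))) := by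
  have hm : 1 < 2 * n := by omega
  haveI : NeZero (2 * n) := ⟨by omega⟩
  haveI : Fact (1 < 2 * n) := ⟨hm⟩
  have h1 : (1 : ZMod (2 * n)).val = 1 := ZMod.val_one _
  have hnv : ((n : ℕ) : ZMod (2 * n)).val = n := ZMod.val_cast_of_lt (by omega)
  constructor
  · intro h
    have step : ∀ i : ZMod (2 * n), (f i - i).val ≤ (f (i + 1) - (i + 1)).val := by
      intro i
      obtain ⟨hne, hI⟩ := h i
      have e1 : i + 1 - i = 1 := by ring
      have e2 : f (i + 1) - i = (f (i + 1) - (i + 1)) + 1 := by ring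
      have hd0 : (f i - i).val ≠ 0 := by
        rw [Ne, ZMod.val_eq_zero, sub_eq_zero]; exact hfpf i
      have hd1 : (f i - i).val ≠ 1 := by
        intro hh
        apply hne
        have : f i - i = 1 := ZMod.val_injective _ (hh.trans h1.symm)
        rw [← this]; ring
      have hne2 : (f (i + 1) - i).val ≠ (f i - i).val := by
        intro hh
        have h3 : f (i + 1) = f i := sub_left_injective (ZMod.val_injective _ hh)
        have h4 := hinv.injective h3
        exact one_ne_zero (add_eq_left.mp h4)
      have hne0 : (f (i + 1) - i).val ≠ 0 := by
        rw [Ne, ZMod.val_eq_zero, sub_eq_zero]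
        intro hh
        apply hne
        rw [← hinv (i + 1), hh]
      have hle : (f (i + 1) - i).val ≤ (f (i + 1) - (i + 1)).val + 1 := by
        rw [e2]
        exact (ZMod.val_add_le _ _).trans (by rw [h1])
      unfold Interlace StrictlyBetween at hI
      rw [e1, h1] at hI
      omega
    have mono : ∀ (k : ℕ) (i : ZMod (2 * n)), (f i - i).val ≤ (f (i + k) - (i + k)).val := by
      intro k
      induction k with
      | zero => intro i; simp
      | succ k ih =>
        intro i
        have := (ih i).trans (step (i + k))
        rw [add_assoc] at this
        exact_mod_cast this
    have all : ∀ i j : ZMod (2 * n), (f i - i).val ≤ (f j - j).val := by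
      intro i j
      have := mono (j - i).val i
      rwa [ZMod.natCast_zmod_val, add_sub_cancel] at this
    intro i
    have heq := le_antisymm (all i (f i)) (all (f i) i)
    rw [hinv i, ← neg_sub (f i) i] at heq
    have hx : f i - i ≠ 0 := sub_ne_zero.mpr (hfpf i)
    haveI : NeZero (f i - i) := ⟨hx⟩
    rw [ZMod.val_neg_of_ne_zero] at heq
    have hlt := ZMod.val_lt (f i - i)
    have : f i - i = (n : ZMod (2 * n)) := ZMod.val_injective _ (by rw [hnv]; omega)
    rw [← this]; ring
  · intro h i
    have hv : (((n : ℕ) : ZMod (2 * n)) + 1).val = n + 1 := by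
      have := ZMod.val_cast_of_lt (n := 2 * n) (a := n + 1) (by omega)
      exact_mod_cast this
    refine ⟨?_, Or.inl ?_⟩
    · rw [h]
      intro hh
      have := congrArg ZMod.val (add_left_cancel hh)
      omega
    · unfold StrictlyBetween
      have e1 : i + 1 - i = 1 := by ring
      have e2 : i + 1 + (n : ZMod (2 * n)) - i = n + 1 := by ring
      rw [h, h, e1, e2, add_sub_cancel_left, hv, h1, hnv]
      omega
end

section
/- Let n ≥ 2 and let f be a chord diagram of size n (a fixed-point-free involution of ZMod (2n)) which is prime (connected interlacement graph) and is not the wheel diagram (f is not the map i ↦ i + n). Then f has two consecutive arcs of different types: there exists i ∈ ZMod (2n) such that the arc (i, i+1) is a ×-arc and the arc (i+1, i+2) is a ∥-arc, or the arc (i, i+1) is a ∥-arc and the arc (i+1, i+2) is a ×-arc. -/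
/-- A property of residues that is invariant under the successor is constant. -/
theorem zmod_const_of_succ {m : ℕ} [NeZero m] {α : Type*} (P : ZMod m → α)
    (h : ∀ i, P (i + 1) = P i) (i : ZMod m) : P i = P 0 := by
  have key : ∀ k : ℕ, P (k : ZMod m) = P 0 := by
    intro k
    induction k with
    | zero => simp
    | succ k ih => rw [Nat.cast_succ, h, ih]
  have := key i.val
  rwa [ZMod.natCast_zmod_val] at this

theorem zmod_val_sub_one {m : ℕ} [Fact (1 < m)] (x : ZMod m) (hx : x ≠ 0) :
    (x - 1).val + 1 = x.val := by
  have h1 : (1 : ZMod m).val = 1 := ZMod.val_one m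
  have hp : 0 < x.val := Nat.pos_of_ne_zero (by rwa [Ne, ZMod.val_eq_zero])
  rw [ZMod.val_sub (by omega), h1]
  omega


/-- The arc `(i, i+1)` of the chord diagram `f` is a `×`-arc. -/
def IsCrossArc {m : ℕ} (f : ZMod m → ZMod m) (i : ZMod m) : Prop :=
  f i ≠ i + 1 ∧ Interlace f i (i + 1)

/-- The arc `(i, i+1)` of the chord diagram `f` is a `∥`-arc. -/
def IsParArc {m : ℕ} (f : ZMod m → ZMod m) (i : ZMod m) : Prop :=
  f i ≠ i + 1 ∧ ¬ Interlace f i (i + 1)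

/-- A prime chord diagram of size `n ≥ 2` which is not the wheel diagram has
two consecutive arcs of different types: for some `i`, the arc `(i, i+1)` is a `×`-arc and the
arc `(i+1, i+2)` is a `∥`-arc, or vice versa. -/
theorem prime_not_wheel_has_mixed_consecutive_arcs (n : ℕ) (hn : 2 ≤ n)
    (f : ZMod (2 * n) → ZMod (2 * n))
    (hinv : Function.Involutive f) (hfpf : ∀ i, f i ≠ i)
    (hprime : (interlacementGraph f).Connected)
    (hwheel : ¬ ∀ i : ZMod (2 * n), f i = i + (n : ZMod (2 * n))) :
    ∃ i : ZMod (2 * n),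
      (IsCrossArc f i ∧ IsParArc f (i + 1)) ∨ (IsParArc f i ∧ IsCrossArc f (i + 1)) := by
  have : Fact (1 < 2 * n) := ⟨by omega⟩
  have : NeZero (2 * n) := ⟨by omega⟩
  have : Nontrivial (ZMod (2 * n)) := ZMod.nontrivial _
  have h1 : (1 : ZMod (2 * n)).val = 1 := ZMod.val_one _
  -- no chord joins neighbouring points
  have hiso : ∀ i, f i ≠ i + 1 := by
    intro i hi
    have hi2 : f (i + 1) = i := by rw [← hi, hinv]
    obtain ⟨w, hw⟩ := hprime.preconnected.exists_adj_of_nontrivial i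
    rw [interlacementGraph, SimpleGraph.fromRel_adj] at hw
    obtain ⟨hne, hw | hw⟩ := hw
    · unfold Interlace StrictlyBetween at hw
      rw [hi, add_sub_cancel_left, h1] at hw
      omega
    · by_cases hw1 : w = i + 1
      · subst hw1
        unfold Interlace StrictlyBetween at hw
        rw [hi2, hi] at hw
        simp at hw
      · have hx0 : (i + 1 - w) ≠ 0 := fun h => hw1 (sub_eq_zero.1 h).symm
        have e1 := zmod_val_sub_one _ hx0
        have e2 : i + 1 - w - 1 = i - w := by ring
        rw [e2] at e1
        have hx : (i - w).val ≠ 0 := by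
          rw [Ne, ZMod.val_eq_zero, sub_eq_zero]; exact hne
        have hy : (i + 1 - w).val ≠ (f w - w).val := by
          intro h
          have h' := sub_left_injective (ZMod.val_injective _ h)
          apply hne
          rw [← hinv w, ← h', hi2]
        unfold Interlace StrictlyBetween at hw
        rw [hi] at hw
        omega
  by_contra hcon
  push Not at hcon
  have hstep : ∀ i, Interlace f (i + 1) (i + 1 + 1) = Interlace f i (i + 1) := by
    intro i
    have := hcon i
    unfold IsCrossArc IsParArc at this
    have a := hiso i
    have b := hiso (i + 1)
    apply propext
    generalize Interlace f (i + 1) (i + 1 + 1) = p at this ⊢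
    generalize Interlace f i (i + 1) = q at this ⊢
    by_cases hp : p <;> by_cases hq : q <;> simp [a, b, hp, hq] at this ⊢
  have hall := zmod_const_of_succ (fun i => Interlace f i (i + 1)) hstep
  set d : ZMod (2 * n) → ℕ := fun i => (f i - i).val with hd
  -- shifting does not change the sum
  have hsum : ∑ i, d (i + 1) = ∑ i, d i :=
    Equiv.sum_comp (Equiv.addRight (1 : ZMod (2 * n))) d
  have hd1 : ∀ i, d (i + 1) + 1 = (f (i + 1) - i).val := by
    intro i
    have : f (i + 1) - i ≠ 0 := by
      intro h
      apply hiso i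
      rw [← sub_eq_zero.1 h, hinv, sub_eq_zero.1 h]
    rw [← zmod_val_sub_one _ this]
    simp only [hd]
    congr 2
    ring
  have hd2 : ∀ i, 2 ≤ d i := by
    intro i
    have a : d i ≠ 0 := by
      simp only [hd]
      rw [Ne, ZMod.val_eq_zero, sub_eq_zero]; exact hfpf i
    have b : d i ≠ 1 := by
      intro h
      apply hiso i
      have : f i - i = 1 := ZMod.val_injective _ (by rw [h1]; exact h)
      rw [← this]; ring
    omega
  have hint : ∀ i, Interlace f i (i + 1) ↔ d i ≤ d (i + 1) + 1 := by
    intro i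
    have a := hd1 i
    have b := hd2 i
    unfold Interlace StrictlyBetween
    rw [add_sub_cancel_left, h1, ← a]
    have e : (f i - i).val = d i := rfl
    rw [e]
    omega
  by_cases h0 : Interlace f 0 (0 + 1)
  · have hle : ∀ i, d i ≤ d (i + 1) := by
      intro i
      have a := (hint i).1 (by rw [hall i]; exact h0)
      have b : d i ≠ d (i + 1) + 1 := by
        rw [hd1]
        intro h
        have h' := hinv.injective (sub_left_injective (ZMod.val_injective _ h))
        exact one_ne_zero (left_eq_add.1 h')
      omega
    have heq := (Finset.sum_eq_sum_iff_of_le (s := Finset.univ) (fun i _ => hle i)).1 hsum.symm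
    have hc := zmod_const_of_succ d (fun i => (heq i (Finset.mem_univ i)).symm)
    have hc' : ∀ i, f i = i + f 0 := by
      intro i
      have := ZMod.val_injective _ (hc i)
      rw [sub_zero] at this
      rw [← this]; ring
    have h2 : f 0 + f 0 = 0 := by rw [← hc' (f 0), hinv]
    have hf0 : f 0 = (n : ZMod (2 * n)) := by
      have hlt := ZMod.val_lt (f 0)
      have hpos : (f 0).val ≠ 0 := by
        rw [Ne, ZMod.val_eq_zero]; exact hfpf 0
      have hdvd : 2 * n ∣ (f 0).val + (f 0).val := by
        rw [← ZMod.natCast_eq_zero_iff, Nat.cast_add, ZMod.natCast_zmod_val, h2]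
      obtain ⟨k, hk⟩ := hdvd
      have hk1 : k = 1 := by
        have : k < 2 := by
          by_contra hk2
          have : 2 * n * 2 ≤ 2 * n * k := Nat.mul_le_mul_left _ (by omega)
          omega
        interval_cases k <;> omega
      subst hk1
      rw [← ZMod.natCast_zmod_val (f 0)]
      congr 1
      omega
    exact hwheel fun i => by rw [hc' i, hf0]
  · have hlt : ∑ i, d (i + 1) < ∑ i, d i := by
      apply Finset.sum_lt_sum_of_nonempty Finset.univ_nonempty
      intro i _
      have : ¬ Interlace f i (i + 1) := by rw [hall i]; exact h0
      rw [hint] at this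
      omega
    omega
end

section
/- Let n ≥ 3 and let f be a prime chord diagram of size n (fixed-point-free involution of ZMod (2n) with connected interlacement graph) satisfying the first parity condition (every chord interlaces an even number of chords), and suppose f is not the wheel diagram of size n. Then f can be produced by a teepee move from a prime chord diagram of size n−1: there exist a prime chord diagram g of size n−1, a chord {u,v} of g and an arc position p of g such that f is (up to rotation of the circle) the diagram obtained from g by the teepee move at ({u,v}, p). -/
/-- First parity condition: every chord of `f` interlaces an even number of chords
(each chord is counted once, via its endpoint `j` with `j.val < (f j).val`). -/
def FirstParity {m : ℕ} (f : ZMod m → ZMod m) : Prop :=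
  ∀ i : ZMod m, Even (Nat.card {j : ZMod m // j.val < (f j).val ∧ Interlace f i j})

/-- The order-preserving re-embedding of the `2(n-1)` points of a chord diagram into
`ZMod (2n)` used by the teepee move at arc position `p`: the point `p` goes to `0`, the two
newly inserted points `p♯`, `q♭` occupy positions `1` and `2`, and every other old point
`p + t` goes to `t + 2`. -/
def teepeeEmbed (n : ℕ) (p : ZMod (2 * (n - 1))) (x : ZMod (2 * (n - 1))) : ZMod (2 * n) :=
  if x = p then 0 else (((x - p).val + 2 : ℕ) : ZMod (2 * n))

/-- The teepee move applied to a chord diagram `g` of size `n - 1` at the chord `{u, g u}`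
and the arc `(p, p + 1)`: insert two new points (at positions `1` and `2` after the image `0`
of `p`), delete the chord `{u, g u}`, and join `u`, `g u` to the two new points; the flag
`swap` selects which of the two possible pairs of new chords is added. -/
def teepee (n : ℕ) (g : ZMod (2 * (n - 1)) → ZMod (2 * (n - 1)))
    (u p : ZMod (2 * (n - 1))) (swap : Bool) : ZMod (2 * n) → ZMod (2 * n) := fun y =>
  if y = 1 then teepeeEmbed n p (if swap then g u else u)
  else if y = 2 then teepeeEmbed n p (if swap then u else g u)
  else
    let x : ZMod (2 * (n - 1)) :=
      if y = 0 then p else p + ((y.val - 2 : ℕ) : ZMod (2 * (n - 1)))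
    if x = u then (if swap then 2 else 1)
    else if x = g u then (if swap then 1 else 2)
    else teepeeEmbed n p (g x)

/-- bad pair of points (linear coordinates) -/
def BadL (N : ℕ) (F : ℕ → ℕ) (y y' : ℕ) : Prop :=
  ∃ s t, s < t ∧ t ≤ N ∧
    ((s ≤ y ∧ y < t ∧ s ≤ y' ∧ y' < t ∧ s + 3 ≤ t ∧ ¬ (s ≤ F y ∧ F y < t) ∧
        ¬ (s ≤ F y' ∧ F y' < t) ∧
        ∀ i, s ≤ i → i < t → i ≠ y → i ≠ y' → s ≤ F i ∧ F i < t) ∨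
     (t - s + 3 ≤ N ∧ ¬ (s ≤ y ∧ y < t) ∧ ¬ (s ≤ y' ∧ y' < t) ∧ s ≤ F y ∧ F y < t ∧
        s ≤ F y' ∧ F y' < t ∧
        ∀ i, s ≤ i → i < t → F i ≠ y → F i ≠ y' → s ≤ F i ∧ F i < t))

structure Ctx (N c : ℕ) (F : ℕ → ℕ) : Prop where
  hc : 3 ≤ c
  hcN : c + 3 ≤ N
  lt : ∀ i, i < N → F i < N
  inv : ∀ i, i < N → F (F i) = i
  par : ∀ i, i < N → (F i + i) % 2 = 1
  prime : ∀ s t, s < t → t ≤ N → t - s < N → ∃ i, s ≤ i ∧ i < t ∧ ¬ (s ≤ F i ∧ F i < t)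
  min : ∀ s t p q, t ≤ c → s + 3 ≤ t → t - s < c →
    ¬ ∀ i, s ≤ i → i < t → ¬ (s ≤ F i ∧ F i < t) → i = p ∨ i = q
  bad : ∀ y, y + 1 < N → BadL N F y (y + 1)
  badw : BadL N F (N - 1) 0

namespace Ctx
variable {N c : ℕ} {F : ℕ → ℕ}

theorem single (h : Ctx N c F) (q : ℕ) (hq : q < c) (hFq : c ≤ F q)
    (hex : ∀ i, i < c → c ≤ F i → i = q) : False := by
  obtain ⟨hc, hcN, lt, inv, par, prime, min, bad, -⟩ := h
  obtain ⟨y, hy, hyq, w, hw, hwy, hwq⟩ : ∃ y, y + 1 < c ∧ (y = q ∨ y + 1 = q) ∧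
      ∃ w, w < c ∧ (w = y ∨ w = y + 1) ∧ w ≠ q := by
    by_cases h1 : q + 1 < c
    · exact ⟨q, h1, Or.inl rfl, q + 1, h1, Or.inr rfl, by omega⟩
    · exact ⟨q - 1, by omega, Or.inr (by omega), q - 1, by omega, Or.inl rfl, by omega⟩
  have hFw : F w < c := by
    by_contra hh
    exact hwq (hex w hw (by omega))
  obtain ⟨s, t, hst, htN, ⟨h1, h2, h3, h4, h5, h6, h7, h8⟩ | ⟨h1, h2, h3, h4, h5, h6, h7, h8⟩⟩ :=
    bad y (by omega)
  · have hqn : ¬ (s ≤ F q ∧ F q < t) := by rcases hyq with rfl | rfl <;> assumption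
    have hwn : ¬ (s ≤ F w ∧ F w < t) := by rcases hwy with rfl | rfl <;> assumption
    by_cases htc : t ≤ c
    · refine min s t y (y+1) htc h5 ?_ ?_
      · by_contra hh
        have : s = 0 ∧ t = c := by omega
        omega
      · intro i hi1 hi2 hi3
        by_contra hh
        push Not at hh
        exact hi3 (h8 i hi1 hi2 hh.1 hh.2)
    · obtain ⟨i, hi1, hi2, hi3⟩ := prime c t (by omega) htN (by omega)
      have h9 := h8 i (by omega) hi2 (by omega) (by omega)
      have h10 := hex (F i) (by omega) (by rw [inv i (by omega)]; exact hi1)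
      have h11 := inv i (by omega)
      rw [h10] at h11
      omega
  · have hqn : (s ≤ F q ∧ F q < t) := by rcases hyq with rfl | rfl <;> constructor <;> assumption
    have hwn : (s ≤ F w ∧ F w < t) := by rcases hwy with rfl | rfl <;> constructor <;> assumption
    by_cases htN' : t = N
    · refine min 0 s y (y+1) (by omega) (by omega) (by omega) ?_
      intro i hi1 hi2 hi3
      by_contra hh
      push Not at hh
      have h10 := lt i (by omega)
      have := h8 (F i) (by omega) (by omega)
      rw [inv i (by omega)] at this
      have := this hh.1 hh.2
      omega
    · obtain ⟨i, hi1, hi2, hi3⟩ := prime t N (by omega) le_rfl (by omega)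
      have h10 := lt i (by omega)
      have h12 := inv i (by omega)
      have h11 : ¬ (s ≤ F i ∧ F i < t) := by
        intro hh
        have := h8 (F i) hh.1 hh.2
        rw [h12] at this
        omega
      have h10 := hex (F i) (by omega) (by omega)
      rw [h10] at h12
      omega

theorem genG (h : Ctx N c F) (q q' y w : ℕ) (hq : q < c) (hq' : q' < c) (hFq : c ≤ F q)
    (hFq' : c ≤ F q') (hex : ∀ i, i < c → c ≤ F i → i = q ∨ i = q')
    (hy : y + 1 < c) (hqw : (q = y ∧ w = y + 1) ∨ (q = y + 1 ∧ w = y))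
    (hn1 : q' ≠ y) (hn2 : q' ≠ y + 1) :
    ∃ t, c < t ∧ t < N ∧
      ((F q' < t ∧ t ≤ F q ∧ F w = 0 ∧ (∀ i, c ≤ i → i < t → i ≠ F q' → c ≤ F i ∧ F i < t) ∧
          (∀ i, t ≤ i → i < N → i ≠ F q → t ≤ F i)) ∨
       (F q < t ∧ t ≤ F q' ∧ F w = c - 1 ∧
          (∀ i, c ≤ i → i < t → i ≠ F q → c ≤ F i ∧ F i < t) ∧
          (∀ i, t ≤ i → i < N → i ≠ F q' → t ≤ F i))) := by
  obtain ⟨hc, hcN, lt, inv, par, prime, min, bad, -⟩ := h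
  have hw : w < c := by omega
  have hFw : F w < c := by
    by_contra hh
    have := hex w hw (by omega)
    omega
  have iq := inv q (by omega)
  have iq' := inv q' (by omega)
  have iw := inv w (by omega)
  have lq := lt q (by omega)
  have lq' := lt q' (by omega)
  obtain ⟨s, t, hst, htN, ⟨h1, h2, h3, h4, h5, h6, h7, h8⟩ | ⟨h1, h2, h3, h4, h5, h6, h7, h8⟩⟩ :=
    bad y (by omega)
  · have hqn : ¬ (s ≤ F q ∧ F q < t) := by rcases hqw with ⟨rfl, rfl⟩ | ⟨rfl, rfl⟩ <;> assumption
    have hwn : ¬ (s ≤ F w ∧ F w < t) := by rcases hqw with ⟨rfl, rfl⟩ | ⟨rfl, rfl⟩ <;> assumption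
    by_cases htc : t ≤ c
    · exfalso
      refine min s t y (y+1) htc h5 ?_ ?_
      · by_contra hh
        have : s = 0 ∧ t = c := by omega
        omega
      · intro i hi1 hi2 hi3
        by_contra hh
        push Not at hh
        exact hi3 (h8 i hi1 hi2 hh.1 hh.2)
    · obtain ⟨i, hi1, hi2, hi3⟩ := prime c t (by omega) htN (by omega)
      have h9 := h8 i (by omega) hi2 (by omega) (by omega)
      have h11 := inv i (by omega)
      have h10 := hex (F i) (by omega) (by omega)
      have h12 : F i = q' := by
        rcases h10 with h10 | h10
        · rw [h10] at h11; omega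
        · exact h10
      rw [h12] at h11
      have hA : ∀ j, j < s → ¬ (F j < s) → j = F w := by
        intro j hj1 hj2
        have hj := inv j (by omega)
        have hjl := lt j (by omega)
        by_cases hjt : F j < t
        · by_cases hy1 : F j = y
          · rcases hqw with ⟨e1, e2⟩ | ⟨e1, e2⟩
            · subst e1; rw [hy1] at hj; omega
            · subst e2; rw [hy1] at hj; omega
          · by_cases hy2 : F j = y + 1
            · rcases hqw with ⟨e1, e2⟩ | ⟨e1, e2⟩
              · subst e2; rw [hy2] at hj; omega
              · subst e1; rw [hy2] at hj; omega
            · have := h8 (F j) (by omega) hjt hy1 hy2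
              omega
        · have := hex j (by omega) (by omega)
          omega
      have hs3 : s < 3 := by
        by_contra hh
        refine min 0 s (F w) (F w) (by omega) (by omega) (by omega) ?_
        intro j _ hj hj2
        exact Or.inl (hA j hj (by omega))
      have hs : s = 1 := by
        by_contra hh
        have hs2 : s = 2 := by omega
        have p0 := par 0 (by omega)
        have p1 := par 1 (by omega)
        have a0 := hA 0 (by omega)
        have a1 := hA 1 (by omega)
        have i0 := inv 0 (by omega)
        have i1 := inv 1 (by omega)
        have ew : F w = 0 ∨ F w = 1 := by omega
        rcases ew with ew | ew <;> rw [ew] at iw a0 a1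
        all_goals
          by_cases b0 : F 0 < s
          · have e0 : F 0 = 1 := by omega
            rw [e0] at i0
            omega
          · by_cases b1 : F 1 < s
            · have e1 : F 1 = 0 := by omega
              rw [e1] at i1
              omega
            · omega
      refine ⟨t, by omega, by omega, Or.inl ⟨by omega, by omega, by omega, ?_, ?_⟩⟩
      · intro j hj1 hj2 hj3
        have hj := h8 j (by omega) hj2 (by omega) (by omega)
        have ij := inv j (by omega)
        by_contra hh
        have := hex (F j) (by omega) (by omega)
        rcases this with e | e <;> rw [e] at ij <;> omega
      · intro j hj1 hj2 hj3
        have ij := inv j (by omega)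
        have lj := lt j (by omega)
        by_contra hh
        by_cases hjc : F j < c
        · have := hex (F j) (by omega) (by omega)
          rcases this with e | e <;> rw [e] at ij <;> omega
        · have := h8 (F j) (by omega) (by omega) (by omega) (by omega)
          omega
  · have hqn : (s ≤ F q ∧ F q < t) := by
      rcases hqw with ⟨rfl, rfl⟩ | ⟨rfl, rfl⟩ <;> constructor <;> assumption
    have hwn : (s ≤ F w ∧ F w < t) := by
      rcases hqw with ⟨rfl, rfl⟩ | ⟨rfl, rfl⟩ <;> constructor <;> assumption
    have h9 : ∀ i, i < N → (i < s ∨ t ≤ i) → i ≠ y → i ≠ y + 1 → F i < s ∨ t ≤ F i := by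
      intro i hi hi2 hi3 hi4
      by_contra hh
      have := h8 (F i) (by omega) (by omega)
      rw [inv i hi] at this
      have := this hi3 hi4
      omega
    by_cases htN' : t = N
    · exfalso
      refine min 0 s y (y+1) (by omega) (by omega) (by omega) ?_
      intro i hi1 hi2 hi3
      by_contra hh
      push Not at hh
      have h10 := lt i (by omega)
      have := h9 i (by omega) (by omega) hh.1 hh.2
      omega
    · obtain ⟨i, hi1, hi2, hi3⟩ := prime t N (by omega) le_rfl (by omega)
      have h10 := lt i (by omega)
      have h11 := inv i (by omega)
      have h12 := h9 i (by omega) (by omega) (by omega) (by omega)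
      have h13 := hex (F i) (by omega) (by omega)
      have h12 : F i = q' := by
        rcases h13 with h13 | h13
        · rw [h13] at h11; omega
        · exact h13
      rw [h12] at h11
      have hA : ∀ j, s ≤ j → j < c → F j < s ∨ c ≤ F j → j = F w := by
        intro j hj1 hj2 hj3
        have hj := inv j (by omega)
        have hjl := lt j (by omega)
        by_cases hjt : F j < s
        · by_cases hy1 : F j = y
          · rcases hqw with ⟨e1, e2⟩ | ⟨e1, e2⟩
            · subst e1; rw [hy1] at hj; omega
            · subst e2; rw [hy1] at hj; omega
          · by_cases hy2 : F j = y + 1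
            · rcases hqw with ⟨e1, e2⟩ | ⟨e1, e2⟩
              · subst e2; rw [hy2] at hj; omega
              · subst e1; rw [hy2] at hj; omega
            · have := h9 (F j) (by omega) (by omega) hy1 hy2
              omega
        · have := hex j (by omega) (by omega)
          omega
      have hs3 : c < s + 3 := by
        by_contra hh
        refine min s c (F w) (F w) (by omega) (by omega) (by omega) ?_
        intro j hj1 hj hj2
        exact Or.inl (hA j hj1 hj (by omega))
      have hs : s = c - 1 := by
        by_contra hh
        have hs2 : s = c - 2 := by omega
        have p0 := par (c-2) (by omega)
        have p1 := par (c-1) (by omega)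
        have a0 := hA (c-2) (by omega) (by omega)
        have a1 := hA (c-1) (by omega) (by omega)
        have i0 := inv (c-2) (by omega)
        have i1 := inv (c-1) (by omega)
        have ew : F w = c-2 ∨ F w = c-1 := by omega
        rcases ew with ew | ew <;> rw [ew] at iw a0 a1
        all_goals
          by_cases b0 : F (c-2) < s ∨ c ≤ F (c-2)
          · by_cases b1 : F (c-1) < s ∨ c ≤ F (c-1)
            · omega
            · have e1 : F (c-1) = c-2 := by omega
              rw [e1] at i1
              omega
          · have e0 : F (c-2) = c-1 := by omega
            rw [e0] at i0
            omega
      refine ⟨t, by omega, by omega, Or.inr ⟨by omega, by omega, by omega, ?_, ?_⟩⟩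
      · intro j hj1 hj2 hj3
        have ij := inv j (by omega)
        have lj := lt j (by omega)
        by_contra hh
        by_cases hjc : F j < c
        · have := hex (F j) (by omega) (by omega)
          rcases this with e | e <;> rw [e] at ij <;> omega
        · have := h9 (F j) (by omega) (by omega) (by omega) (by omega)
          omega
      · intro j hj1 hj2 hj3
        have ij := inv j (by omega)
        have lj := lt j (by omega)
        have := h9 j hj2 (by omega) (by omega) (by omega)
        by_contra hh
        have := hex (F j) (by omega) (by omega)
        rcases this with e | e <;> rw [e] at ij <;> omega


theorem nonadj (h : Ctx N c F) (q q' : ℕ) (hqq : q + 1 < q') (hq' : q' < c) (hFq : c ≤ F q)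
    (hFq' : c ≤ F q') (hex : ∀ i, i < c → c ≤ F i → i = q ∨ i = q') : False := by
  have hcN := h.hcN
  have key : ∀ w, w < c → (w + 1 = q ∨ w = q + 1 ∨ w + 1 = q' ∨ w = q' + 1) →
      F 0 = w ∨ F (c - 1) = w := by
    intro w hw hw2
    have iw := h.inv w (by omega)
    have : F w = 0 ∨ F w = c - 1 := by
      rcases hw2 with e | e | e | e
      · obtain ⟨t, -, -, ⟨-, -, h1, -⟩ | ⟨-, -, h1, -⟩⟩ := h.genG q q' w w (by omega) hq' hFq hFq'
          hex (by omega) (by omega) (by omega) (by omega)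
        · exact Or.inl h1
        · exact Or.inr h1
      · obtain ⟨t, -, -, ⟨-, -, h1, -⟩ | ⟨-, -, h1, -⟩⟩ := h.genG q q' q w (by omega) hq' hFq hFq'
          hex (by omega) (by omega) (by omega) (by omega)
        · exact Or.inl h1
        · exact Or.inr h1
      · obtain ⟨t, -, -, ⟨-, -, h1, -⟩ | ⟨-, -, h1, -⟩⟩ := h.genG q' q w w (by omega) (by omega)
          hFq' hFq (fun i a b => (hex i a b).symm) (by omega) (by omega) (by omega) (by omega)
        · exact Or.inl h1
        · exact Or.inr h1
      · obtain ⟨t, -, -, ⟨-, -, h1, -⟩ | ⟨-, -, h1, -⟩⟩ := h.genG q' q q' w (by omega) (by omega)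
          hFq' hFq (fun i a b => (hex i a b).symm) (by omega) (by omega) (by omega) (by omega)
        · exact Or.inl h1
        · exact Or.inr h1
    rcases this with e | e <;> rw [e] at iw
    · exact Or.inl iw
    · exact Or.inr iw
  have k1 := key (q + 1) (by omega) (by omega)
  have k2 := key (q' - 1) (by omega) (by omega)
  have k3 : q = 0 ∨ (F 0 = q - 1 ∨ F (c - 1) = q - 1) := by
    by_cases h0 : q = 0
    · exact Or.inl h0
    · exact Or.inr (key (q - 1) (by omega) (by omega))
  have k4 : q' = c - 1 ∨ (F 0 = q' + 1 ∨ F (c - 1) = q' + 1) := by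
    by_cases h0 : q' = c - 1
    · exact Or.inl h0
    · exact Or.inr (key (q' + 1) (by omega) (by omega))
  have k5 : q = 0 → c ≤ F 0 := by rintro rfl; exact hFq
  have k6 : q' = c - 1 → c ≤ F (c - 1) := by rintro rfl; exact hFq'
  omega

theorem genH (h : Ctx N c F) (q y : ℕ) (hq : 1 ≤ q) (hFq : c ≤ F q)
    (hFq' : c ≤ F (q + 1)) (hex : ∀ i, i < c → c ≤ F i → i = q ∨ i = q + 1)
    (hK : F (q + 2) = c - 1 ∨ F (q + 2) = 0)
    (hy : y + 1 < c) (hqy : q + 2 ≤ y) : F (y + 1) = F y + 1 ∨ F y = F (y + 1) + 1 := by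
  obtain ⟨hc, hcN, lt, inv, par, prime, min, bad, -⟩ := h
  have hin : ∀ i, i < c → i ≠ q → i ≠ q + 1 → F i < c := by
    intro i h1 h2 h3
    by_contra hh
    have := hex i h1 (by omega)
    omega
  have hin' : ∀ i, i < c → F i ≠ q ∧ F i ≠ q + 1 := by
    intro i h1
    have := inv i (by omega)
    constructor <;> intro e <;> rw [e] at this <;> omega
  have f1 := hin y (by omega) (by omega) (by omega)
  have f2 := hin (y + 1) (by omega) (by omega) (by omega)
  have g1 := hin' y (by omega)
  have g2 := hin' (y + 1) (by omega)
  have iy1 := inv y (by omega)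
  have iy2 := inv (y + 1) (by omega)
  have hne : F y ≠ F (y + 1) := by
    intro e; rw [e] at iy1; omega
  obtain ⟨s, t, hst, htN, ⟨h1, h2, h3, h4, h5, h6, h7, h8⟩ | ⟨h1, h2, h3, h4, h5, h6, h7, h8⟩⟩ :=
    bad y (by omega)
  · by_cases htc : t ≤ c
    · exfalso
      refine min s t y (y+1) htc h5 ?_ ?_
      · by_contra hh
        have : s = 0 ∧ t = c := by omega
        omega
      · intro i hi1 hi2 hi3
        by_contra hh
        push Not at hh
        exact hi3 (h8 i hi1 hi2 hh.1 hh.2)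
    · by_cases htN' : t = N
      · have hs3 : s < 3 := by
          by_contra hh
          refine min 0 s (F y) (F (y + 1)) (by omega) (by omega) (by omega) ?_
          intro i hi1 hi2 hi3
          have ii := inv i (by omega)
          have il := lt i (by omega)
          by_contra hh
          by_cases e1 : F i = y
          · rw [e1] at ii; omega
          · by_cases e2 : F i = y + 1
            · rw [e2] at ii; omega
            · have := h8 (F i) (by omega) (by omega) e1 e2
              omega
        omega
      · exfalso
        obtain ⟨i, hi1, hi2, hi3⟩ := prime c t (by omega) htN (by omega)
        have h9 := h8 i (by omega) hi2 (by omega) (by omega)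
        have h11 := inv i (by omega)
        have h10 := hex (F i) (by omega) (by omega)
        obtain ⟨j, hj1, hj2, hj3⟩ := prime t N (by omega) le_rfl (by omega)
        have j11 := inv j (by omega)
        have jl := lt j (by omega)
        have j9 : F j < s := by
          by_contra hh
          by_cases e1 : F j = y
          · rw [e1] at j11; omega
          · by_cases e2 : F j = y + 1
            · rw [e2] at j11; omega
            · have := h8 (F j) (by omega) (by omega) e1 e2
              omega
        have j10 := hex (F j) (by omega) (by omega)
        have hs : s = q + 1 := by omega
        have hc4 : c ≤ q + 4 := by
          by_contra hh
          refine min (q + 2) c y (y + 1) (by omega) (by omega) (by omega) ?_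
          intro k hk1 hk2 hk3
          by_contra hh
          have := h8 k (by omega) (by omega) (by omega) (by omega)
          have a1 := hin k hk2 (by omega) (by omega)
          have a2 := hin' k hk2
          omega
        have hy4 : y = q + 2 ∧ c = q + 4 := by omega
        have hq3 : q < 3 := by
          by_contra hh
          refine min 0 q (F y) (F (y + 1)) (by omega) (by omega) (by omega) ?_
          intro k hk1 hk2 hk3
          have a1 := hin k (by omega) (by omega) (by omega)
          have a2 := hin' k (by omega)
          have a3 := inv k (by omega)
          have : F k = y ∨ F k = y + 1 := by omega
          rcases this with e | e <;> rw [e] at a3 <;> omega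
        have hp := par y (by omega)
        rw [← hy4.1] at hK
        omega
  · have h9 : ∀ i, i < N → (i < s ∨ t ≤ i) → i ≠ y → i ≠ y + 1 → F i < s ∨ t ≤ F i := by
      intro i hi hi2 hi3 hi4
      by_contra hh
      have := h8 (F i) (by omega) (by omega)
      rw [inv i hi] at this
      have := this hi3 hi4
      omega
    by_cases htc : t ≤ c
    · have hs3 : t - s < 3 := by
        by_contra hh
        refine min s t (F y) (F (y + 1)) (by omega) (by omega) (by omega) ?_
        intro i hi1 hi2 hi3
        have ii := inv i (by omega)
        by_contra hh
        by_cases e1 : F i = y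
        · rw [e1] at ii; omega
        · by_cases e2 : F i = y + 1
          · rw [e2] at ii; omega
          · exact hi3 (h8 i hi1 hi2 e1 e2)
      omega
    · exfalso
      by_cases htN' : t = N
      · refine min 0 s y (y+1) (by omega) (by omega) (by omega) ?_
        intro i hi1 hi2 hi3
        by_contra hh
        push Not at hh
        have h10 := lt i (by omega)
        have := h9 i (by omega) (by omega) hh.1 hh.2
        omega
      · obtain ⟨j, hj1, hj2, hj3⟩ := prime c t (by omega) (by omega) (by omega)
        have j11 := inv j (by omega)
        have jl := lt j (by omega)
        have e1 : F j ≠ y := by intro e; rw [e] at j11; omega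
        have e2 : F j ≠ y + 1 := by intro e; rw [e] at j11; omega
        have := h8 j (by omega) (by omega) e1 e2
        have := hex (F j) (by omega) (by omega)
        omega

theorem adj (h : Ctx N c F) (q : ℕ) (hq' : q + 1 < c) (hFq : c ≤ F q)
    (hFq' : c ≤ F (q + 1)) (hex : ∀ i, i < c → c ≤ F i → i = q ∨ i = q + 1) : False := by
  have hc := h.hc
  have hcN := h.hcN
  have hin : ∀ i, i < c → i ≠ q → i ≠ q + 1 → F i < c := by
    intro i h1 h2 h3
    by_contra hh
    have := hex i h1 (by omega)
    omega
  have hin' : ∀ i, i < c → F i ≠ q ∧ F i ≠ q + 1 := by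
    intro i h1
    have := h.inv i (by omega)
    constructor <;> intro e <;> rw [e] at this <;> omega
  have hq1 : 1 ≤ q := by
    by_contra hh
    obtain ⟨i, h1, h2, h3⟩ := h.prime 2 c (by omega) (by omega) (by omega)
    have a1 := hin i h2 (by omega) (by omega)
    have a2 := hin' i h2
    omega
  have hq2 : q + 2 < c := by
    by_contra hh
    obtain ⟨i, h1, h2, h3⟩ := h.prime 0 q (by omega) (by omega) (by omega)
    have a1 := hin i (by omega) (by omega) (by omega)
    have a2 := hin' i (by omega)
    omega
  obtain ⟨t, ht1, ht2, hR⟩ := h.genG (q + 1) q (q + 1) (q + 2) hq' (by omega) hFq' hFq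
    (fun i a b => (hex i a b).symm) (by omega) (by omega) (by omega) (by omega)
  obtain ⟨t', ht1', ht2', hL⟩ := h.genG q (q + 1) (q - 1) (q - 1) (by omega) hq' hFq hFq'
    hex (by omega) (by omega) (by omega) (by omega)
  have hH : F (q + 2) = c - 1 ∨ F (q + 2) = 0 := by
    rcases hR with ⟨-, -, e, -⟩ | ⟨-, -, e, -⟩
    · exact Or.inr e
    · exact Or.inl e
  have H := fun y => h.genH q y hq1 hFq hFq' hex hH
  rcases hR with ⟨b1, b2, b3, b4, b5⟩ | ⟨b1, b2, b3, -, -⟩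
  · -- main case
    have hL3 : F (q - 1) = c - 1 := by
      rcases hL with ⟨d1, d2, d3, -⟩ | ⟨-, -, d3, -⟩
      · omega
      · exact d3
    have hlin : ∀ i, q + 2 + i < c → F (q + 2 + i) = i := by
      intro i
      induction i using Nat.strong_induction_on with
      | _ i ih =>
        intro hi
        rcases i with _ | i
        · exact b3
        · have e1 := ih i (by omega) (by omega)
          have e2 := H (q + 2 + i) (by omega) (by omega)
          rw [show q + 2 + i + 1 = q + 2 + (i + 1) by ring] at e2
          rcases i with _ | i
          · omega
          · have e3 := ih i (by omega) (by omega)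
            have i1 := h.inv (q + 2 + i) (by omega)
            have i2 := h.inv (q + 2 + (i + 1 + 1)) (by omega)
            rcases e2 with e2 | e2
            · omega
            · rw [e3] at i1
              rw [show F (q + 2 + (i + 1 + 1)) = i by omega] at i2
              omega
    have hc2 : c = 2 * q + 2 := by
      have e1 := hlin (c - 1 - (q + 2)) (by omega)
      rw [show q + 2 + (c - 1 - (q + 2)) = c - 1 by omega] at e1
      have i1 := h.inv (q - 1) (by omega)
      rw [hL3] at i1
      omega
    have iq := h.inv q (by omega)
    have iq1 := h.inv (q + 1) (by omega)
    have lq := h.lt q (by omega)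
    have lq1 := h.lt (q + 1) (by omega)
    have icc := h.inv c (by omega)
    have eC1 : F (c - 1) = q - 1 := by
      have e1 := hlin (q - 1) (by omega)
      rwa [show q + 2 + (q - 1) = c - 1 by omega] at e1
    have ht0 : t = c + 1 := by
      have claim : F c = q → t = c + 1 := by
        intro e
        rw [e] at icc
        by_contra hh
        obtain ⟨i, i1, i2, i3⟩ := h.prime (c + 1) t (by omega) (by omega) (by omega)
        have := b4 i (by omega) i2 (by omega)
        have ii := h.inv i (by omega)
        have : F i ≠ c := by
          intro e'
          rw [e'] at ii
          omega
        omega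
      have claim2 : F c < c → t = c + 1 := by
        intro e
        apply claim
        have := hex (F c) e (by omega)
        rcases this with e | e
        · exact e
        · rw [e] at icc; omega
      have claim3 : F c < c ∨ (c ≤ F c ∧ F c < t) := by
        by_cases e : c = F q
        · left; rw [← e] at iq; omega
        · right; exact b4 c (by omega) (by omega) e
      obtain ⟨s, u, hst, htN, ⟨h1, h2, h3, h4, h5, h6, h7, h8⟩ |
        ⟨h1, h2, h3, h4, h5, h6, h7, h8⟩⟩ := h.bad (c - 1) (by omega)
      · rw [show c - 1 + 1 = c by omega] at h3 h4 h7 h8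
        by_cases hs : s = c - 1
        · exfalso
          obtain ⟨i, i1, i2, i3⟩ := h.prime (c + 1) u (by omega) (by omega) (by omega)
          have := h8 i (by omega) i2 (by omega) (by omega)
          have ii := h.inv i (by omega)
          have n1 : F i ≠ c := by
            intro e'
            rw [e'] at ii
            rw [ii] at h7
            omega
          have n2 : F i ≠ c - 1 := by
            intro e'
            rw [e'] at ii
            omega
          omega
        · have e1 := h8 (c - 2) (by omega) (by omega) (by omega) (by omega)
          by_cases hq1 : q = 1
          · rw [show c - 2 = q + 1 by omega] at e1
            omega
          · have e2 := hlin (q - 2) (by omega)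
            rw [show q + 2 + (q - 2) = c - 2 by omega] at e2
            omega
      · rw [show c - 1 + 1 = c by omega] at h3 h6 h7 h8
        omega
    have hFqc : F q = c := by omega
    have eF0 : F 0 = q + 2 := by
      have i1 := h.inv (q + 2) (by omega)
      rwa [b3] at i1
    have hn1 : F (N - 1) ≠ q + 1 := by
      intro e
      have i1 := h.inv (N - 1) (by omega)
      rw [e] at i1
      obtain ⟨i, i1, i2, i3⟩ := h.prime t (N - 1) (by omega) (by omega) (by omega)
      have := b5 i (by omega) (by omega) (by omega)
      have il := h.lt i (by omega)
      have ii := h.inv i (by omega)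
      have : F i ≠ N - 1 := by
        intro e'
        rw [e'] at ii
        omega
      omega
    have iN := h.inv (N - 1) (by omega)
    have lN := h.lt (N - 1) (by omega)
    have hn2 : t ≤ F (N - 1) := by
      apply b5 _ (by omega) (by omega)
      intro e
      rw [← e] at iq1
      omega
    obtain ⟨s, u, hst, htN, ⟨h1, h2, h3, h4, h5, h6, h7, h8⟩ |
        ⟨h1, h2, h3, h4, h5, h6, h7, h8⟩⟩ := h.badw
    · omega
    · rw [hFqc] at iq
      have c1 := h8 c (by omega) (by omega) (by omega) (by omega)
      have n0 : F (q + 1) ≠ N - 1 := by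
        intro e
        rw [e] at iq1
        exact hn1 iq1
      have c2 := h8 (q + 1) (by omega) (by omega) (by omega) (by omega)
      have hs : s = 1 := by
        by_contra hh
        have e2 := hlin 1 (by omega)
        have := h8 (q + 2 + 1) (by omega) (by omega) (by omega) (by omega)
        omega
      obtain ⟨i, i1, i2, i3⟩ := h.prime u (N - 1) (by omega) (by omega) (by omega)
      have ii := h.inv i (by omega)
      have il := h.lt i (by omega)
      have n1 : F i ≠ N - 1 := by
        intro e'
        rw [e'] at ii
        omega
      have n2 : F i ≠ 0 := by
        intro e'
        rw [e'] at ii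
        omega
      have := h8 (F i) (by omega) (by omega) (by omega) (by omega)
      omega
  · have hlin : ∀ i, q + 2 + i < c → F (q + 2 + i) + i = c - 1 := by
      intro i
      induction i using Nat.strong_induction_on with
      | _ i ih =>
        intro hi
        rcases i with _ | i
        · exact b3
        · have e1 := ih i (by omega) (by omega)
          have e2 := H (q + 2 + i) (by omega) (by omega)
          have e4 := hin (q + 2 + (i + 1)) (by omega) (by omega) (by omega)
          rw [show q + 2 + i + 1 = q + 2 + (i + 1) by ring] at e2
          rcases i with _ | i
          · omega
          · have e3 := ih i (by omega) (by omega)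
            have i1 := h.inv (q + 2 + i) (by omega)
            have i2 := h.inv (q + 2 + (i + 1 + 1)) (by omega)
            rcases e2 with e2 | e2
            · rw [show F (q + 2 + (i + 1 + 1)) = F (q + 2 + i) by omega, i1] at i2
              omega
            · omega
    have hp := h.par (q + 2) (by omega)
    rw [b3] at hp
    obtain ⟨k, hk⟩ : ∃ k, c - 1 = q + 2 + 2 * k + 1 := ⟨(c - 1 - (q + 2)) / 2, by omega⟩
    have e1 := hlin k (by omega)
    have e2 := hlin (k + 1) (by omega)
    obtain ⟨i, i1, i2, i3⟩ := h.prime (q + 2 + k) (q + 2 + k + 2) (by omega) (by omega) (by omega)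
    have : i = q + 2 + k ∨ i = q + 2 + (k + 1) := by omega
    rcases this with rfl | rfl <;> omega

theorem false_of_cut (h : Ctx N c F) (p p' : ℕ)
    (hcut : ∀ i, i < c → c ≤ F i → i = p ∨ i = p') : False := by
  have hc := h.hc
  have hcN := h.hcN
  obtain ⟨q, h1, h2, h3⟩ := h.prime 0 c (by omega) (by omega) (by omega)
  by_cases hs : ∀ i, i < c → c ≤ F i → i = q
  · exact h.single q h2 (by omega) hs
  · push Not at hs
    obtain ⟨q', h4, h5, h6⟩ := hs
    have hex : ∀ i, i < c → c ≤ F i → i = q ∨ i = q' := by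
      intro i a b
      have a1 := hcut i a b
      have a2 := hcut q h2 (by omega)
      have a3 := hcut q' h4 h5
      omega
    have hFq : c ≤ F q := by omega
    rcases Nat.lt_or_gt_of_ne h6 with hl | hl
    · by_cases ha : q = q' + 1
      · subst ha
        exact h.adj q' h2 h5 hFq (fun i a b => (hex i a b).symm)
      · exact h.nonadj q' q (by omega) h2 h5 hFq (fun i a b => (hex i a b).symm)
    · by_cases ha : q' = q + 1
      · subst ha
        exact h.adj q h4 hFq h5 hex
      · exact h.nonadj q q' (by omega) h4 hFq h5 hex

end Ctx

section ZModLayer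
variable {N : ℕ} [NeZero N]

theorem valsub (a x i : ZMod N) : ((x - a).val ≤ (i - a).val ∧
      (i - x).val = (i - a).val - (x - a).val) ∨
    ((i - a).val < (x - a).val ∧ (i - x).val = N + (i - a).val - (x - a).val) := by
  have h1 := ZMod.val_lt (x - a)
  have h2 := ZMod.val_lt (i - a)
  have h3 := ZMod.val_lt (i - x)
  have h := ZMod.val_add (i - x) (x - a)
  rw [sub_add_sub_cancel] at h
  by_cases hlt : (i - x).val + (x - a).val < N
  · rw [Nat.mod_eq_of_lt hlt] at h
    omega
  · rw [Nat.mod_eq_sub_mod (by omega), Nat.mod_eq_of_lt (by omega)] at h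
    omega

theorem val_sub_inj (a x y : ZMod N) (h : (x - a).val = (y - a).val) : x = y := by
  have := ZMod.val_injective N h
  simpa using this

theorem val_add_sub (a : ZMod N) (i : ℕ) (hi : i < N) : (a + (i : ZMod N) - a).val = i := by
  rw [add_sub_cancel_left, ZMod.val_natCast_of_lt hi]

theorem add_val_sub (a z : ZMod N) : a + (((z - a).val : ℕ) : ZMod N) = z := by
  rw [ZMod.natCast_zmod_val]; ring

/-- no proper invariant arc, in coordinates based at `a` -/
def LinPrime (f : ZMod N → ZMod N) (a : ZMod N) : Prop :=
  ∀ s t, s < t → t ≤ N → t - s < N → ∃ i : ZMod N, s ≤ (i - a).val ∧ (i - a).val < t ∧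
    ¬ (s ≤ (f i - a).val ∧ (f i - a).val < t)

def BadZ (f : ZMod N → ZMod N) (x : ZMod N) : Prop :=
  ∃ s t, 2 ≤ s ∧ s < t ∧ t ≤ N ∧ t + 3 ≤ N + s ∧ s ≤ (f x - x).val ∧ (f x - x).val < t ∧
    s ≤ (f (x + 1) - x).val ∧ (f (x + 1) - x).val < t ∧
    ∀ i : ZMod N, s ≤ (i - x).val → (i - x).val < t → f i ≠ x → f i ≠ x + 1 →
      s ≤ (f i - x).val ∧ (f i - x).val < t

def Fa (f : ZMod N → ZMod N) (a : ZMod N) (i : ℕ) : ℕ := (f (a + (i : ZMod N)) - a).val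

theorem Fa_val (f : ZMod N → ZMod N) (a z : ZMod N) : Fa f a (z - a).val = (f z - a).val := by
  unfold Fa; rw [add_val_sub]

theorem badL_of_badZ (hN : 3 ≤ N) (f : ZMod N → ZMod N) (hinv : Function.Involutive f) (a x : ZMod N)
    (h : BadZ f x) : BadL N (Fa f a) (x - a).val (x + 1 - a).val := by
  obtain ⟨s, t, h1, h2, h3, h4, h5, h6, h7, h8, h9⟩ := h
  have one : (x + 1 - x).val = 1 := by
    rw [add_sub_cancel_left]
    exact ZMod.val_one'' (by omega)
  have vx := valsub a x (x + 1)
  rw [one] at vx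
  have lx := ZMod.val_lt (x - a)
  have lx1 := ZMod.val_lt (x + 1 - a)
  have vf := valsub a x (f x)
  have vf1 := valsub a x (f (x + 1))
  have lf := ZMod.val_lt (f x - a)
  have lf1 := ZMod.val_lt (f (x + 1) - a)
  have key : ∀ i, i < N → Fa f a i ≠ (x - a).val → Fa f a i ≠ (x + 1 - a).val →
      s ≤ (a + (i : ZMod N) - x).val → (a + (i : ZMod N) - x).val < t →
      s ≤ (f (a + (i : ZMod N)) - x).val ∧ (f (a + (i : ZMod N)) - x).val < t := by
    intro i hi e1 e2 g1 g2
    refine h9 _ g1 g2 ?_ ?_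
    · intro e; apply e1; unfold Fa; rw [e]
    · intro e; apply e2; unfold Fa; rw [e]
  by_cases c1 : t + (x - a).val ≤ N
  · refine ⟨s + (x - a).val, t + (x - a).val, by omega, by omega, Or.inr ?_⟩
    rw [Fa_val, Fa_val]
    refine ⟨by omega, by omega, by omega, by omega, by omega, by omega, by omega, ?_⟩
    intro i g1 g2 g3 g4
    have v := valsub a x (a + (i : ZMod N))
    have v' := valsub a x (f (a + (i : ZMod N)))
    rw [val_add_sub a i (by omega)] at v
    have k := key i (by omega) g3 g4 (by omega) (by omega)
    have l := ZMod.val_lt (f (a + (i : ZMod N)) - a)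
    unfold Fa
    omega
  by_cases c2 : N ≤ s + (x - a).val
  · refine ⟨s + (x - a).val - N, t + (x - a).val - N, by omega, by omega, Or.inr ?_⟩
    rw [Fa_val, Fa_val]
    refine ⟨by omega, by omega, by omega, by omega, by omega, by omega, by omega, ?_⟩
    intro i g1 g2 g3 g4
    have v := valsub a x (a + (i : ZMod N))
    have v' := valsub a x (f (a + (i : ZMod N)))
    rw [val_add_sub a i (by omega)] at v
    have k := key i (by omega) g3 g4 (by omega) (by omega)
    have l := ZMod.val_lt (f (a + (i : ZMod N)) - a)
    unfold Fa
    omega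
  · refine ⟨t + (x - a).val - N, s + (x - a).val, by omega, by omega, Or.inl ?_⟩
    rw [Fa_val, Fa_val]
    refine ⟨by omega, by omega, by omega, by omega, by omega, by omega, by omega, ?_⟩
    intro i g1 g2 g3 g4
    have v := valsub a x (a + (i : ZMod N))
    have v' := valsub a x (f (a + (i : ZMod N)))
    rw [val_add_sub a i (by omega)] at v
    have l := ZMod.val_lt (f (a + (i : ZMod N)) - a)
    unfold Fa
    by_contra hh
    have k := h9 (f (a + (i : ZMod N))) (by omega) (by omega)
    rw [hinv] at k
    have n1 : a + (i : ZMod N) ≠ x := by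
      intro e; apply g3; rw [← e, val_add_sub a i (by omega)]
    have n2 : a + (i : ZMod N) ≠ x + 1 := by
      intro e; apply g4; rw [← e, val_add_sub a i (by omega)]
    have := k n1 n2
    omega

/-- nontrivial small cut of size `c` -/
def CutZ (f : ZMod N → ZMod N) (c : ℕ) : Prop :=
  3 ≤ c ∧ c + 3 ≤ N ∧ ∃ a p q : ZMod N, ∀ i : ZMod N, (i - a).val < c → c ≤ (f i - a).val →
    i = p ∨ i = q

theorem no_cut (hN : Even N) (f : ZMod N → ZMod N) (hinv : Function.Involutive f)
    (hpar : ∀ i, Odd (f i - i).val) (hprime : ∀ a, LinPrime f a) (hbad : ∀ x, BadZ f x) (c : ℕ) :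
    ¬ CutZ f c := by
  classical
  intro hex
  have hex' : ∃ c, CutZ f c := ⟨c, hex⟩
  have hmin : ∀ m, m < Nat.find hex' → ¬ CutZ f m := fun m hm => Nat.find_min hex' hm
  have hc := Nat.find_spec hex'
  generalize Nat.find hex' = c at hmin hc
  clear hex hex'
  obtain ⟨h3, h4, a, p, q, hcut⟩ := hc
  have ctx : Ctx N c (Fa f a) := by
    refine ⟨h3, h4, ?_, ?_, ?_, ?_, ?_, ?_, ?_⟩
    · intro i _; exact ZMod.val_lt _
    · intro i hi
      change (f (a + (((f (a + (i : ZMod N)) - a).val : ℕ) : ZMod N)) - a).val = i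
      rw [add_val_sub, hinv]
      exact val_add_sub a i hi
    · intro i hi
      have h := hpar (a + (i : ZMod N))
      have v := valsub a (a + (i : ZMod N)) (f (a + (i : ZMod N)))
      rw [val_add_sub a i hi] at v
      obtain ⟨k, hk⟩ := h
      obtain ⟨m, hm⟩ := hN
      unfold Fa
      omega
    · intro s t h1 h2 h3
      obtain ⟨i, i1, i2, i3⟩ := hprime a s t h1 h2 h3
      refine ⟨(i - a).val, i1, i2, ?_⟩
      rwa [Fa_val]
    · intro s t p q h1 h2 h3 hh
      refine hmin (t - s) h3 ⟨by omega, by omega, a + (s : ZMod N), a + (p : ZMod N),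
        a + (q : ZMod N), ?_⟩
      intro i i1 i2
      have v := valsub a (a + (s : ZMod N)) i
      have v' := valsub a (a + (s : ZMod N)) (f i)
      rw [val_add_sub a s (by omega)] at v v'
      have l := ZMod.val_lt (i - a)
      have l' := ZMod.val_lt (f i - a)
      have := hh (i - a).val (by omega) (by omega) (by rw [Fa_val]; omega)
      rcases this with e | e
      · left; rw [← e, add_val_sub]
      · right; rw [← e, add_val_sub]
    · intro y hy
      have := badL_of_badZ (by omega) f hinv a (a + (y : ZMod N)) (hbad _)
      rw [val_add_sub a y (by omega)] at this
      rwa [show a + (y : ZMod N) + 1 = a + ((y + 1 : ℕ) : ZMod N) by push_cast; ring,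
        val_add_sub a (y + 1) hy] at this
    · have := badL_of_badZ (by omega) f hinv a (a + ((N - 1 : ℕ) : ZMod N)) (hbad _)
      rw [val_add_sub a (N - 1) (by omega)] at this
      have e : ((N - 1 : ℕ) : ZMod N) = -1 := by
        rw [Nat.cast_sub (by omega)]; simp
      rwa [show a + ((N - 1 : ℕ) : ZMod N) + 1 - a = 0 by rw [e]; ring, ZMod.val_zero] at this
  refine ctx.false_of_cut (p - a).val (q - a).val ?_
  intro i i1 i2
  have := hcut (a + (i : ZMod N)) (by rw [val_add_sub a i (by omega)]; exact i1) i2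
  rcases this with e | e
  · left; rw [← e, val_add_sub a i (by omega)]
  · right; rw [← e, val_add_sub a i (by omega)]

theorem local_of_bad (hN : Even N) (f : ZMod N → ZMod N) (hinv : Function.Involutive f)
    (hpar : ∀ i, Odd (f i - i).val) (hprime : ∀ a, LinPrime f a) (hbad : ∀ x, BadZ f x)
    (x : ZMod N) : f (x + 1) = f x + 1 ∨ f (x + 1) = f x - 1 := by
  obtain ⟨s, t, h1, h2, h3, h4, h5, h6, h7, h8, h9⟩ := hbad x
  have hts : t < s + 3 := by
    by_contra hh
    refine no_cut hN f hinv hpar hprime hbad (t - s) ⟨by omega, by omega, x + (s : ZMod N),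
      f x, f (x + 1), ?_⟩
    intro i i1 i2
    have v := valsub x (x + (s : ZMod N)) i
    have v' := valsub x (x + (s : ZMod N)) (f i)
    rw [val_add_sub x s (by omega)] at v v'
    have l := ZMod.val_lt (i - x)
    have l' := ZMod.val_lt (f i - x)
    by_contra hh
    push Not at hh
    have := h9 i (by omega) (by omega) (fun e => hh.1 (by rw [← e, hinv]))
      (fun e => hh.2 (by rw [← e, hinv]))
    omega
  have one : (1 : ZMod N) ≠ 0 := by
    have : Fact (1 < N) := ⟨by omega⟩
    exact one_ne_zero
  have hne : (f x - x).val ≠ (f (x + 1) - x).val := by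
    intro e
    have := hinv.injective (val_sub_inj x _ _ e)
    exact one (by simpa using this.symm)
  have e1 := add_val_sub x (f x)
  have e2 := add_val_sub x (f (x + 1))
  have : (f (x + 1) - x).val = (f x - x).val + 1 ∨ (f x - x).val = (f (x + 1) - x).val + 1 := by
    omega
  rcases this with e | e
  · left
    rw [e] at e2
    rw [← e2]; push_cast; rw [← add_assoc, e1]
  · right
    rw [e] at e1
    rw [← e1]; push_cast; rw [← add_assoc, e2]; ring

end ZModLayer

theorem wheel_of_bad (n : ℕ) (hn : 3 ≤ n) [NeZero (2 * n)] (f : ZMod (2 * n) → ZMod (2 * n))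
    (hinv : Function.Involutive f)
    (hpar : ∀ i, Odd (f i - i).val) (hprime : ∀ a, LinPrime f a) (hbad : ∀ x, BadZ f x) :
    ∀ i, f i = i + (n : ZMod (2 * n)) := by
  have loc := local_of_bad (even_two_mul n) f hinv hpar hprime hbad
  have two : (2 : ZMod (2 * n)) ≠ 0 := by
    intro e
    have : ((2 : ℕ) : ZMod (2 * n)) = 0 := by exact_mod_cast e
    rw [ZMod.natCast_eq_zero_iff] at this
    have := Nat.le_of_dvd (by omega) this
    omega
  have step : ∀ x, f (x + 1) = f x + 1 → f (x + 1 + 1) = f (x + 1) + 1 := by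
    intro x h
    rcases loc (x + 1) with h' | h'
    · exact h'
    · exfalso
      rw [h, add_sub_cancel_right] at h'
      have := hinv.injective h'
      apply two
      have : x + 1 + 1 - x = 0 := by rw [this]; ring
      rw [← this]; ring
  by_cases hp : ∃ x, f (x + 1) = f x + 1
  · obtain ⟨x, hx⟩ := hp
    have all : ∀ k : ℕ, f (x + k) = f x + k ∧ f (x + k + 1) = f (x + k) + 1 := by
      intro k
      induction k with
      | zero => simpa using hx
      | succ k ih =>
        push_cast
        rw [← add_assoc, ← add_assoc]
        exact ⟨by rw [ih.2, ih.1], step _ ih.2⟩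
    have hf : ∀ z, f z = z + (f x - x) := by
      intro z
      have := (all (z - x).val).1
      rw [add_val_sub, ZMod.natCast_zmod_val] at this
      rw [this]; ring
    have hk : (f x - x) + (f x - x) = 0 := by
      have h1 := hinv x
      rw [hf (f x)] at h1
      have : f x + (f x - x) - x = 0 := by rw [h1]; ring
      rw [← this]; ring
    have hodd := hpar x
    have hlt := ZMod.val_lt (f x - x)
    have e : (f x - x).val = n := by
      have h1 : (((f x - x).val + (f x - x).val : ℕ) : ZMod (2 * n)) = 0 := by
        push_cast
        rw [ZMod.natCast_zmod_val]; exact hk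
      rw [ZMod.natCast_eq_zero_iff] at h1
      obtain ⟨m, hm⟩ := h1
      obtain ⟨j, hj⟩ := hodd
      have : m < 2 := by
        by_contra hh
        have : 2 * n * 2 ≤ 2 * n * m := Nat.mul_le_mul_left _ (by omega)
        omega
      interval_cases m <;> omega
    intro i
    have e' := congrArg (Nat.cast : ℕ → ZMod (2 * n)) e
    rw [ZMod.natCast_zmod_val] at e'
    rw [hf i, e']
  · exfalso
    push Not at hp
    have dec : ∀ k : ℕ, f (k : ZMod (2 * n)) = f 0 - k := by
      intro k
      induction k with
      | zero => simp
      | succ k ih =>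
        have := (loc (k : ZMod (2 * n))).resolve_left (hp _)
        push_cast
        rw [this, ih]; ring
    obtain ⟨m, hm⟩ := hpar 0
    rw [sub_zero] at hm
    have h1 : f (m : ZMod (2 * n)) = m + 1 := by
      rw [dec, ← ZMod.natCast_zmod_val (f 0), hm]; push_cast; ring
    have h2 : f ((m : ZMod (2 * n)) + 1) = m := by rw [← h1, hinv]
    obtain ⟨i, i1, i2, i3⟩ := hprime (m : ZMod (2 * n)) 0 2 (by omega) (by omega) (by omega)
    have e := add_val_sub (m : ZMod (2 * n)) i
    apply i3
    refine ⟨Nat.zero_le _, ?_⟩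
    have hv : (i - (m : ZMod (2 * n))).val = 0 ∨ (i - (m : ZMod (2 * n))).val = 1 := by omega
    rcases hv with hv | hv <;> rw [hv] at e
    · rw [← e, Nat.cast_zero, add_zero, h1, add_sub_cancel_left, ZMod.val_one'' (by omega)]
      omega
    · rw [← e, Nat.cast_one, h2, sub_self, ZMod.val_zero]
      omega

section Graph
variable {N : ℕ} [NeZero N]

def BtwN (I I' J : ℕ) : Prop := (I < J ∧ J < I') ∨ (I' < J ∧ J < I)

theorem interlace_iff (f : ZMod N → ZMod N) (hinv : Function.Involutive f) (hfpf : ∀ i, f i ≠ i)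
    (a i j : ZMod N) : Interlace f i j ↔
      ¬ (BtwN (i - a).val (f i - a).val (j - a).val ↔
        BtwN (i - a).val (f i - a).val (f j - a).val) := by
  have v1 := valsub a i (f i)
  have v2 := valsub a i j
  have v3 := valsub a i (f j)
  have l1 := ZMod.val_lt (i - a)
  have l2 := ZMod.val_lt (f i - a)
  have l3 := ZMod.val_lt (j - a)
  have l4 := ZMod.val_lt (f j - a)
  have n0 : (f i - a).val ≠ (i - a).val := fun e => hfpf i (val_sub_inj a _ _ e)
  by_cases e1 : j = i
  · subst e1
    unfold Interlace StrictlyBetween BtwN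
    simp
  by_cases e2 : j = f i
  · subst e2
    rw [hinv]
    unfold Interlace StrictlyBetween BtwN
    rw [hinv]
    simp
  have e3 : f j ≠ i := fun e => e2 (by rw [← e, hinv])
  have e4 : f j ≠ f i := fun e => e1 (hinv.injective e)
  have m1 : (j - a).val ≠ (i - a).val := fun e => e1 (val_sub_inj a _ _ e)
  have m2 : (j - a).val ≠ (f i - a).val := fun e => e2 (val_sub_inj a _ _ e)
  have m3 : (f j - a).val ≠ (i - a).val := fun e => e3 (val_sub_inj a _ _ e)
  have m4 : (f j - a).val ≠ (f i - a).val := fun e => e4 (val_sub_inj a _ _ e)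
  unfold Interlace StrictlyBetween BtwN
  omega

theorem adj_iff (f : ZMod N → ZMod N) (hinv : Function.Involutive f) (hfpf : ∀ i, f i ≠ i)
    (a i j : ZMod N) : (interlacementGraph f).Adj i j ↔
      ¬ (BtwN (i - a).val (f i - a).val (j - a).val ↔
        BtwN (i - a).val (f i - a).val (f j - a).val) := by
  unfold interlacementGraph
  rw [SimpleGraph.fromRel_adj]
  constructor
  · rintro ⟨hne, h | h⟩
    · exact (interlace_iff f hinv hfpf a i j).1 h
    · have h' := (interlace_iff f hinv hfpf a j i).1 h
      have n0 : (f i - a).val ≠ (i - a).val := fun e => hfpf i (val_sub_inj a _ _ e)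
      have n1 : (f j - a).val ≠ (j - a).val := fun e => hfpf j (val_sub_inj a _ _ e)
      have m1 : (j - a).val ≠ (i - a).val := fun e => hne (val_sub_inj a _ _ e).symm
      by_cases e2 : j = f i
      · subst e2
        rw [hinv] at h'
        unfold BtwN at h'
        exfalso
        omega
      have e3 : f j ≠ i := fun e => e2 (by rw [← e, hinv])
      have e4 : f j ≠ f i := fun e => hne (hinv.injective e).symm
      have m2 : (j - a).val ≠ (f i - a).val := fun e => e2 (val_sub_inj a _ _ e)
      have m3 : (f j - a).val ≠ (i - a).val := fun e => e3 (val_sub_inj a _ _ e)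
      have m4 : (f j - a).val ≠ (f i - a).val := fun e => e4 (val_sub_inj a _ _ e)
      unfold BtwN at h' ⊢
      omega
  · intro h
    refine ⟨?_, Or.inl ((interlace_iff f hinv hfpf a i j).2 h)⟩
    rintro rfl
    unfold BtwN at h
    omega

theorem linPrime_of_connected (f : ZMod N → ZMod N) (hinv : Function.Involutive f)
    (hfpf : ∀ i, f i ≠ i) (hc : (interlacementGraph f).Connected) (a : ZMod N) :
    LinPrime f a := by
  intro s t hst ht hN
  by_contra hh
  push Not at hh
  let S : Set (ZMod N) := {i | s ≤ (i - a).val ∧ (i - a).val < t}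
  have hS : ∀ i ∈ S, f i ∈ S := fun i hi => hh i hi.1 hi.2
  have hu : a + (s : ZMod N) ∈ S := by
    change _ ∧ _
    rw [val_add_sub a s (by omega)]
    omega
  obtain ⟨v, hv⟩ : ∃ v, v ∉ S := by
    by_cases h0 : s = 0
    · refine ⟨a + (t : ZMod N), ?_⟩
      change ¬ (_ ∧ _)
      rw [val_add_sub a t (by omega)]
      omega
    · refine ⟨a + ((0 : ℕ) : ZMod N), ?_⟩
      change ¬ (_ ∧ _)
      rw [val_add_sub a 0 (by omega)]
      omega
  obtain ⟨w⟩ := hc.preconnected (a + (s : ZMod N)) v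
  obtain ⟨d, -, h1, h2⟩ := w.exists_boundary_dart S hu hv
  have h3 := hS _ h1
  have h4 : f d.snd ∉ S := fun e => h2 (by have := hS _ e; rwa [hinv] at this)
  have h5 := (adj_iff f hinv hfpf a _ _).1 d.adj
  change _ ∧ _ at h1
  change ¬ (_ ∧ _) at h2
  change _ ∧ _ at h3
  change ¬ (_ ∧ _) at h4
  unfold BtwN at h5
  omega

theorem connected_of_linPrime (hN : 3 ≤ N) (g : ZMod N → ZMod N) (hinv : Function.Involutive g)
    (hfpf : ∀ i, g i ≠ i) (a : ZMod N) (hp : LinPrime g a) :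
    (interlacementGraph g).Connected := by
  classical
  have hadj := adj_iff g hinv hfpf a
  have nonisol : ∀ x, ∃ y, (interlacementGraph g).Adj x y := by
    intro x
    by_contra hno
    push Not at hno
    have l1 := ZMod.val_lt (x - a)
    have l2 := ZMod.val_lt (g x - a)
    have n0 : (g x - a).val ≠ (x - a).val := fun e => hfpf x (val_sub_inj a _ _ e)
    have inj : ∀ i, (g i - a).val = (x - a).val → (i - a).val = (g x - a).val := by
      intro i e
      rw [← val_sub_inj a _ _ e, hinv]
    have inj' : ∀ i, (g i - a).val = (g x - a).val → (i - a).val = (x - a).val := by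
      intro i e
      rw [hinv.injective (val_sub_inj a _ _ e)]
    have hno' : ∀ i, (BtwN (x - a).val (g x - a).val (i - a).val ↔
        BtwN (x - a).val (g x - a).val (g i - a).val) := by
      intro i
      by_contra hh
      exact hno i ((hadj x i).2 hh)
    obtain ⟨lo, hi, hlh, hcase⟩ : ∃ lo hi, lo < hi ∧ ((lo = (x - a).val ∧ hi = (g x - a).val) ∨
        (hi = (x - a).val ∧ lo = (g x - a).val)) := by
      rcases Nat.lt_or_gt_of_ne n0 with h | h
      · exact ⟨_, _, h, Or.inr ⟨rfl, rfl⟩⟩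
      · exact ⟨_, _, h, Or.inl ⟨rfl, rfl⟩⟩
    by_cases hw : hi + 1 - lo < N
    · obtain ⟨i, i1, i2, i3⟩ := hp lo (hi + 1) (by omega) (by omega) hw
      have h1 := hno' i
      have h2 := inj i
      have h3 := inj' i
      have h4 : (i - a).val = (x - a).val → (g i - a).val = (g x - a).val := by
        intro e; rw [val_sub_inj a _ _ e]
      have h5 : (i - a).val = (g x - a).val → (g i - a).val = (x - a).val := by
        intro e; rw [val_sub_inj a _ _ e, hinv]
      unfold BtwN at h1
      omega
    · obtain ⟨i, i1, i2, i3⟩ := hp 1 (N - 1) (by omega) (by omega) (by omega)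
      have h1 := hno' i
      have h2 := inj i
      have h3 := inj' i
      have l3 := ZMod.val_lt (g i - a)
      omega
  have adj_g : ∀ x y, (interlacementGraph g).Adj x y → (interlacementGraph g).Adj (g x) y := by
    intro x y h
    rw [hadj] at h ⊢
    rw [hinv]
    unfold BtwN at h ⊢
    omega
  let R : ZMod N → Prop := fun z => (interlacementGraph g).Reachable a z
  have Radj : ∀ x y, R x → (interlacementGraph g).Adj x y → R y :=
    fun x y h1 h2 => h1.trans h2.reachable
  have Rg : ∀ x, R x → R (g x) := by
    intro x hx
    obtain ⟨y, hy⟩ := nonisol x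
    exact Radj y _ (Radj x y hx hy) (adj_g x y hy).symm
  have Ra : R a := SimpleGraph.Reachable.refl a
  suffices hall : ∀ y, R y by
    have : Nonempty (ZMod N) := ⟨0⟩
    exact ⟨fun u v => (hall u).symm.trans (hall v)⟩
  intro y
  by_contra hy
  have lY := ZMod.val_lt (y - a)
  have RY : ¬ R (a + ((y - a).val : ZMod N)) := by rwa [add_val_sub]
  generalize (y - a).val = Y at lY RY
  obtain ⟨s, hsY, hsR, hs⟩ : ∃ s, s < Y ∧ R (a + (s : ZMod N)) ∧
      ∀ k, s < k → k ≤ Y → ¬ R (a + (k : ZMod N)) := by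
    have hex : ∃ d, d ≤ Y ∧ R (a + ((Y - d : ℕ) : ZMod N)) := ⟨Y, le_rfl, by simpa using Ra⟩
    have h1 := Nat.find_spec hex
    have h2 := fun m => Nat.find_min (m := m) hex
    generalize Nat.find hex = d at h1 h2
    refine ⟨Y - d, ?_, h1.2, ?_⟩
    · rcases Nat.eq_zero_or_pos d with h0 | h0
      · exfalso; apply RY; have := h1.2; rwa [h0, Nat.sub_zero] at this
      · omega
    · intro k hk1 hk2 hk3
      refine h2 (Y - k) (by omega) ⟨by omega, ?_⟩
      rwa [show Y - (Y - k) = k by omega]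
  obtain ⟨t, htY, htN, htR, ht⟩ : ∃ t, Y < t ∧ t ≤ N ∧ (t < N → R (a + (t : ZMod N))) ∧
      ∀ k, Y ≤ k → k < t → ¬ R (a + (k : ZMod N)) := by
    have hex : ∃ t, Y < t ∧ (t = N ∨ R (a + (t : ZMod N))) := ⟨N, lY, Or.inl rfl⟩
    have h1 := Nat.find_spec hex
    have h2 := fun m => Nat.find_min (m := m) hex
    have h3 : Nat.find hex ≤ N := Nat.find_min' hex ⟨lY, Or.inl rfl⟩
    generalize Nat.find hex = t at h1 h2 h3
    refine ⟨t, h1.1, h3, fun hlt => h1.2.resolve_left (by omega), ?_⟩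
    intro k hk1 hk2 hk3
    rcases Nat.eq_or_lt_of_le hk1 with e | e
    · exact RY (e ▸ hk3)
    · exact h2 k hk2 ⟨e, Or.inr hk3⟩
  have hT : ∀ k, s < k → k < t → ¬ R (a + (k : ZMod N)) := by
    intro k h1 h2
    rcases Nat.le_total k Y with h | h
    · exact hs k h1 h
    · exact ht k h h2
  obtain ⟨i, i1, i2, i3⟩ := hp (s + 1) t (by omega) htN (by omega)
  have hRi : ¬ R i := by
    have := hT (i - a).val (by omega) i2
    rwa [add_val_sub] at this
  have hRgi : ¬ R (g i) := fun e => hRi (by have := Rg _ e; rwa [hinv] at this)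
  have ne1 : ∀ z, R z → (z - a).val ≠ (i - a).val := by
    intro z hz e
    exact hRi (val_sub_inj a _ _ e ▸ hz)
  have ne2 : ∀ z, R z → (z - a).val ≠ (g i - a).val := by
    intro z hz e
    exact hRgi (val_sub_inj a _ _ e ▸ hz)
  have side : ∀ z, R z → (BtwN (i - a).val (g i - a).val (z - a).val ↔
      BtwN (i - a).val (g i - a).val (g z - a).val) := by
    intro z hz
    by_contra hh
    exact hRi (Radj z i hz ((hadj i z).2 hh).symm)
  have hconst : ∀ z, R z → ¬ BtwN (i - a).val (g i - a).val (z - a).val := by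
    intro z hz hB
    obtain ⟨w⟩ := hz
    obtain ⟨d, -, h1, h2⟩ := w.exists_boundary_dart
      {z | R z ∧ ¬ BtwN (i - a).val (g i - a).val (z - a).val}
      ⟨Ra, by rw [sub_self, ZMod.val_zero]; unfold BtwN; omega⟩ (fun h => h.2 hB)
    have hd : R d.snd := Radj _ _ h1.1 d.adj
    have h2' : BtwN (i - a).val (g i - a).val (d.snd - a).val := by
      by_contra hh
      exact h2 ⟨hd, hh⟩
    have h3 := (side _ h1.1).not.1 h1.2
    have h4 := (side _ hd).1 h2'
    have h5 := (hadj _ _).1 d.adj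
    have h1' := h1.2
    have a1 := ne1 _ h1.1
    have a2 := ne1 _ hd
    have a3 := ne1 _ (Rg _ h1.1)
    have a4 := ne1 _ (Rg _ hd)
    have b1 := ne2 _ h1.1
    have b2 := ne2 _ hd
    have b3 := ne2 _ (Rg _ h1.1)
    have b4 := ne2 _ (Rg _ hd)
    unfold BtwN at h1' h2' h3 h4 h5
    omega
  have c1 := hconst _ hsR
  have c3 := ne2 _ hsR
  rw [val_add_sub a s (by omega)] at c1 c3
  have lg := ZMod.val_lt (g i - a)
  unfold BtwN at c1
  have htlt : t < N := by omega
  have c2 := hconst _ (htR htlt)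
  have c4 := ne2 _ (htR htlt)
  rw [val_add_sub a t htlt] at c2 c4
  unfold BtwN at c2
  omega

theorem even_card_of_invol (s : Finset (ZMod N)) (f : ZMod N → ZMod N)
    (hinv : Function.Involutive f) (hfpf : ∀ i, f i ≠ i) (hs : ∀ x ∈ s, f x ∈ s) :
    Even s.card := by
  have h : ∑ _x ∈ s, (1 : ZMod 2) = 0 := by
    refine Finset.sum_involution (fun x _ => f x) ?_ ?_ ?_ ?_
    · intro x _; decide
    · intro x _ _; exact hfpf x
    · intro x hx; exact hs x hx
    · intro x _; exact hinv x
  rw [Finset.sum_const, nsmul_eq_mul, mul_one, ZMod.natCast_eq_zero_iff] at h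
  exact even_iff_two_dvd.2 h

theorem firstParity_iff (f : ZMod N → ZMod N)
    (hinv : Function.Involutive f) (hfpf : ∀ i, f i ≠ i) :
    FirstParity f ↔ ∀ i, Odd (f i - i).val := by
  classical
  unfold FirstParity
  refine forall_congr' fun i => ?_
  let B : Finset (ZMod N) := Finset.univ.filter fun b => StrictlyBetween i (f i) b
  have memB : ∀ b, b ∈ B ↔ StrictlyBetween i (f i) b := by intro b; simp [B]
  have hk : 0 < (f i - i).val := by
    rw [Nat.pos_iff_ne_zero]
    intro e
    rw [ZMod.val_eq_zero, sub_eq_zero] at e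
    exact hfpf i e
  have hlt := ZMod.val_lt (f i - i)
  have cB : B.card = (f i - i).val - 1 := by
    have : B.card = (Finset.Ioo 0 (f i - i).val).card := by
      refine Finset.card_bij (fun b _ => (b - i).val) ?_ ?_ ?_
      · intro b hb
        rw [memB] at hb
        exact Finset.mem_Ioo.2 hb
      · intro b _ b' _ e
        exact val_sub_inj i _ _ e
      · intro k hk
        rw [Finset.mem_Ioo] at hk
        refine ⟨i + (k : ZMod N), ?_, val_add_sub i k (by omega)⟩
        rw [memB]
        unfold StrictlyBetween
        rw [val_add_sub i k (by omega)]
        exact hk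
    rw [this, Nat.card_Ioo]
    omega
  have h1 : Even (B.filter fun b => f b ∈ B).card := by
    refine even_card_of_invol _ f hinv hfpf ?_
    intro x hx
    rw [Finset.mem_filter] at hx ⊢
    rw [hinv]
    exact ⟨hx.2, hx.1⟩
  have h2 := Finset.card_filter_add_card_filter_not (s := B) (fun b => f b ∈ B)
  have h3 : Nat.card {j : ZMod N // j.val < (f j).val ∧ Interlace f i j} =
      (B.filter fun b => ¬ f b ∈ B).card := by
    rw [Nat.card_eq_fintype_card, Fintype.card_subtype]
    have hne : ∀ j, j.val ≠ (f j).val := fun j e => hfpf j (ZMod.val_injective N e).symm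
    refine Finset.card_bij (fun j _ => if j ∈ B then j else f j) ?_ ?_ ?_
    · intro j hj
      rw [Finset.mem_filter] at hj
      have hI := hj.2.2
      unfold Interlace at hI
      rw [← memB, ← memB] at hI
      rw [Finset.mem_filter]
      split_ifs with hjB
      · tauto
      · rw [hinv]; tauto
    · intro j hj j' hj' e
      rw [Finset.mem_filter] at hj hj'
      have a1 := hj.2.1
      have a2 := hj'.2.1
      split_ifs at e
      · exact e
      · subst e
        rw [hinv] at a1
        omega
      · subst e
        rw [hinv] at a2
        omega
      · exact hinv.injective e
    · intro b hb
      rw [Finset.mem_filter] at hb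
      by_cases hlt : b.val < (f b).val
      · refine ⟨b, ?_, if_pos hb.1⟩
        rw [Finset.mem_filter]
        refine ⟨Finset.mem_univ _, hlt, ?_⟩
        unfold Interlace
        rw [← memB, ← memB]
        tauto
      · refine ⟨f b, ?_, ?_⟩
        · rw [Finset.mem_filter, hinv]
          have := hne b
          refine ⟨Finset.mem_univ _, by omega, ?_⟩
          unfold Interlace
          rw [hinv, ← memB, ← memB]
          tauto
        · simp only [if_neg hb.2]
          exact hinv b
  rw [h3]
  rw [Nat.even_iff] at h1 ⊢
  rw [Nat.odd_iff]
  omega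

end Graph

section Unteepee

theorem emb_val (n : ℕ) (hn : 3 ≤ n) (x : ZMod (2 * (n - 1))) :
    (x.val = 0 ∧ (teepeeEmbed n 0 x).val = 0) ∨
      (0 < x.val ∧ (teepeeEmbed n 0 x).val = x.val + 2) := by
  have : NeZero (2 * (n - 1)) := ⟨by omega⟩
  have : NeZero (2 * n) := ⟨by omega⟩
  have l := ZMod.val_lt x
  unfold teepeeEmbed
  by_cases hx : x = 0
  · left
    simp [hx]
  · right
    rw [if_neg hx, sub_zero, ZMod.val_natCast_of_lt (by omega)]
    refine ⟨?_, rfl⟩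
    rw [Nat.pos_iff_ne_zero]
    intro e
    exact hx ((ZMod.val_eq_zero x).1 e)

/-- left inverse of the embedding -/
def redZ (n : ℕ) (y : ZMod (2 * n)) : ZMod (2 * (n - 1)) :=
  if y = 0 then 0 else ((y.val - 2 : ℕ) : ZMod (2 * (n - 1)))

theorem red_val (n : ℕ) (hn : 3 ≤ n) (y : ZMod (2 * n)) :
    (y.val = 0 ∧ (redZ n y).val = 0) ∨
      (0 < y.val ∧ (redZ n y).val = y.val - 2) := by
  have : NeZero (2 * (n - 1)) := ⟨by omega⟩
  have : NeZero (2 * n) := ⟨by omega⟩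
  have l := ZMod.val_lt y
  unfold redZ
  by_cases hx : y = 0
  · left
    simp [hx]
  · right
    rw [if_neg hx, ZMod.val_natCast_of_lt (by omega)]
    refine ⟨?_, rfl⟩
    rw [Nat.pos_iff_ne_zero]
    intro e
    exact hx ((ZMod.val_eq_zero y).1 e)

theorem val_one_aux (n : ℕ) (hn : 3 ≤ n) : (1 : ZMod (2 * n)).val = 1 :=
  ZMod.val_one'' (by omega)

theorem val_two_aux (n : ℕ) (hn : 3 ≤ n) : (2 : ZMod (2 * n)).val = 2 := by
  have h : ((2 : ℕ) : ZMod (2 * n)).val = 2 := ZMod.val_natCast_of_lt (by omega)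
  exact h

theorem emb_red (n : ℕ) (hn : 3 ≤ n) (y : ZMod (2 * n)) (h1 : y ≠ 1) (h2 : y ≠ 2) :
    teepeeEmbed n 0 (redZ n y) = y := by
  have : NeZero (2 * n) := ⟨by omega⟩
  apply ZMod.val_injective
  have v1 : y.val ≠ 1 := fun e => h1 (ZMod.val_injective _ (e.trans (val_one_aux n hn).symm))
  have v2 : y.val ≠ 2 := fun e => h2 (ZMod.val_injective _ (e.trans (val_two_aux n hn).symm))
  have e1 := emb_val n hn (redZ n y)
  have e2 := red_val n hn y
  omega

theorem emb_ne (n : ℕ) (hn : 3 ≤ n) (x : ZMod (2 * (n - 1))) :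
    teepeeEmbed n 0 x ≠ 1 ∧ teepeeEmbed n 0 x ≠ 2 := by
  have e1 := emb_val n hn x
  constructor
  · intro e
    rw [e, val_one_aux n hn] at e1
    omega
  · intro e
    rw [e, val_two_aux n hn] at e1
    omega

theorem emb_inj (n : ℕ) (hn : 3 ≤ n) (x y : ZMod (2 * (n - 1)))
    (h : teepeeEmbed n 0 x = teepeeEmbed n 0 y) : x = y := by
  have : NeZero (2 * (n - 1)) := ⟨by omega⟩
  apply ZMod.val_injective
  have e1 := emb_val n hn x
  have e2 := emb_val n hn y
  rw [h] at e1
  omega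

/-- the diagram `h` with the points `1`, `2` merged away -/
def mergeZ (n : ℕ) (h : ZMod (2 * n) → ZMod (2 * n)) (y : ZMod (2 * n)) : ZMod (2 * n) :=
  if h y = 1 then h 2 else if h y = 2 then h 1 else h y

theorem unteepee (n : ℕ) (hn : 3 ≤ n) [NeZero (2 * n)] [NeZero (2 * (n - 1))]
    (h : ZMod (2 * n) → ZMod (2 * n))
    (hinv : Function.Involutive h) (hfpf : ∀ i, h i ≠ i) (hp : LinPrime h 0)
    (hb : ¬ BadZ h 1) :
    ∃ (g : ZMod (2 * (n - 1)) → ZMod (2 * (n - 1))) (u : ZMod (2 * (n - 1))),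
      Function.Involutive g ∧ (∀ i, g i ≠ i) ∧ LinPrime g 0 ∧
        ∀ y, teepee n g u 0 false y = h y := by
  have o1 := val_one_aux n hn
  have o2 := val_two_aux n hn
  have ne12 : (1 : ZMod (2 * n)) ≠ 2 := by
    intro e
    have := congrArg ZMod.val e
    omega
  have h12 : h 1 ≠ 2 := by
    intro e
    have e' : h 2 = 1 := by rw [← e, hinv]
    obtain ⟨i, i1, i2, i3⟩ := hp 1 3 (by omega) (by omega) (by omega)
    simp only [sub_zero] at i1 i2 i3
    have : i = 1 ∨ i = 2 := by
      rcases (show i.val = 1 ∨ i.val = 2 by omega) with hh | hh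
      · exact Or.inl (ZMod.val_injective _ (hh.trans o1.symm))
      · exact Or.inr (ZMod.val_injective _ (hh.trans o2.symm))
    rcases this with rfl | rfl
    · rw [e] at i3; omega
    · rw [e'] at i3; omega
  have h21 : h 2 ≠ 1 := fun e => h12 (by rw [← e, hinv])
  have h11 := hfpf 1
  have h22 := hfpf 2
  have inv1 : ∀ y, h y = 1 → y = h 1 := fun y e => by rw [← e, hinv]
  have inv2 : ∀ y, h y = 2 → y = h 2 := fun y e => by rw [← e, hinv]
  -- properties of the merged map
  have Gne : ∀ y, y ≠ 1 → y ≠ 2 → mergeZ n h y ≠ 1 ∧ mergeZ n h y ≠ 2 := by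
    intro y y1 y2
    unfold mergeZ
    split_ifs with a b
    · exact ⟨h21, h22⟩
    · exact ⟨h11, h12⟩
    · exact ⟨a, b⟩
  have Ginv : ∀ y, y ≠ 1 → y ≠ 2 → mergeZ n h (mergeZ n h y) = y := by
    intro y y1 y2
    unfold mergeZ
    split_ifs with a b c d e k
    all_goals grind [hinv 1, hinv 2, hinv y]
  have Gfpf : ∀ y, y ≠ 1 → y ≠ 2 → mergeZ n h y ≠ y := by
    intro y y1 y2
    unfold mergeZ
    split_ifs with a b
    all_goals grind [hinv 1, hinv 2, hinv y, hfpf y]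
  let g : ZMod (2 * (n - 1)) → ZMod (2 * (n - 1)) :=
    fun x => redZ n (mergeZ n h (teepeeEmbed n 0 x))
  have hg : ∀ x, teepeeEmbed n 0 (g x) = mergeZ n h (teepeeEmbed n 0 x) := by
    intro x
    have := emb_ne n hn x
    have := Gne _ this.1 this.2
    exact emb_red n hn _ this.1 this.2
  have ginv : Function.Involutive g := by
    intro x
    apply emb_inj n hn
    have := emb_ne n hn x
    rw [hg, hg, Ginv _ this.1 this.2]
  have gfpf : ∀ x, g x ≠ x := by
    intro x e
    have := emb_ne n hn x
    apply Gfpf _ this.1 this.2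
    rw [← hg, e]
  have hu : teepeeEmbed n 0 (redZ n (h 1)) = h 1 := emb_red n hn _ h11 h12
  have hgu : teepeeEmbed n 0 (g (redZ n (h 1))) = h 2 := by
    rw [hg, hu]
    unfold mergeZ
    rw [if_pos (hinv 1)]
  refine ⟨g, redZ n (h 1), ginv, gfpf, ?_, ?_⟩
  · -- primality
    have main : ∀ s t, 1 ≤ s → s < t → t ≤ 2 * (n - 1) →
        ¬ ∀ x : ZMod (2 * (n - 1)), s ≤ x.val → x.val < t → s ≤ (g x).val ∧ (g x).val < t := by
      intro s t hs hst ht H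
      have HG : ∀ y : ZMod (2 * n), s + 2 ≤ y.val → y.val < t + 2 →
          s + 2 ≤ (mergeZ n h y).val ∧ (mergeZ n h y).val < t + 2 := by
        intro y y1 y2
        have n1 : y ≠ 1 := by rintro rfl; omega
        have n2 : y ≠ 2 := by rintro rfl; omega
        have e1 := emb_red n hn y n1 n2
        have v1 := emb_val n hn (redZ n y)
        rw [e1] at v1
        have h1 := H (redZ n y) (by omega) (by omega)
        have v2 := emb_val n hn (g (redZ n y))
        rw [hg, e1] at v2
        omega
      have m1 : mergeZ n h (h 1) = h 2 := by
        unfold mergeZ; rw [if_pos (hinv 1)]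
      have m2 : mergeZ n h (h 2) = h 1 := by
        unfold mergeZ; rw [hinv, if_neg ne12.symm, if_pos rfl]
      have c1 := HG (h 1)
      have c2 := HG (h 2)
      rw [m1] at c1
      rw [m2] at c2
      have m3 : ∀ y, h y ≠ 1 → h y ≠ 2 → mergeZ n h y = h y := by
        intro y a b
        unfold mergeZ; rw [if_neg a, if_neg b]
      by_cases hin : s + 2 ≤ (h 1).val ∧ (h 1).val < t + 2
      · apply hb
        have c1 := c1 hin.1 hin.2
        have w : ∀ i : ZMod (2 * n), (1 ≤ i.val ∧ (i - 1).val = i.val - 1) ∨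
            (i.val < 1 ∧ (i - 1).val = 2 * n + i.val - 1) := by
          intro i
          have := valsub 0 1 i
          simpa only [sub_zero, o1] using this
        have e2 : (1 : ZMod (2 * n)) + 1 = 2 := one_add_one_eq_two
        unfold BadZ
        rw [e2]
        refine ⟨s + 1, t + 1, by omega, by omega, by omega, by omega, ?_, ?_, ?_, ?_, ?_⟩
        · have := w (h 1); omega
        · have := w (h 1); omega
        · have := w (h 2); omega
        · have := w (h 2); omega
        · intro i i1 i2 i3 i4
          have w1 := w i
          have w2 := w (h i)
          have := HG i (by omega) (by omega)
          rw [m3 i i3 i4] at this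
          omega
      · obtain ⟨i, i1, i2, i3⟩ := hp (s + 2) (t + 2) (by omega) (by omega) (by omega)
        simp only [sub_zero] at i1 i2 i3
        have k1 : h i ≠ 1 := fun e => hin (by rw [← inv1 i e]; exact ⟨i1, i2⟩)
        have k2 : h i ≠ 2 := fun e => hin (by
          have := inv2 i e
          rw [← this] at c2
          exact c2 i1 i2)
        have := HG i i1 i2
        rw [m3 i k1 k2] at this
        exact i3 this
    intro s t hst ht hlt
    by_contra hh
    push Not at hh
    simp only [sub_zero] at hh
    rcases Nat.eq_zero_or_pos s with h0 | h0
    · refine main t (2 * (n - 1)) (by omega) (by omega) le_rfl ?_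
      intro x x1 x2
      refine ⟨?_, ZMod.val_lt _⟩
      by_contra hc
      have := hh (g x) (by omega) (by omega)
      rw [ginv] at this
      omega
    · exact main s t h0 hst ht hh
  · intro y
    unfold teepee
    by_cases y1 : y = 1
    · rw [if_pos y1, y1]
      simpa using hu
    by_cases y2 : y = 2
    · rw [if_neg y1, if_pos y2, y2]
      simpa using hgu
    rw [if_neg y1, if_neg y2]
    have hx : (if y = 0 then (0 : ZMod (2 * (n - 1))) else
        0 + ((y.val - 2 : ℕ) : ZMod (2 * (n - 1)))) = redZ n y := by
      unfold redZ; rw [zero_add]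
    have ey := emb_red n hn y y1 y2
    simp only [hx, Bool.false_eq_true, if_false]
    by_cases a : redZ n y = redZ n (h 1)
    · rw [if_pos a]
      rw [a, hu] at ey
      rw [← ey, hinv]
    by_cases b : redZ n y = g (redZ n (h 1))
    · rw [if_neg a, if_pos b]
      rw [b, hgu] at ey
      rw [← ey, hinv]
    rw [if_neg a, if_neg b, hg, ey]
    unfold mergeZ
    have k1 : h y ≠ 1 := fun e => a (by rw [inv1 y e])
    have k2 : h y ≠ 2 := fun e => b (by
      apply emb_inj n hn
      rw [ey, hgu]
      exact inv2 y e)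
    rw [if_neg k1, if_neg k2]

end Unteepee

/-- Every prime chord diagram `f` of size `n ≥ 3` satisfying the first
parity condition which is not the wheel diagram is produced, up to rotation of the circle,
by a teepee move (with the choice of new chords for which the first parity condition holds)
from some prime chord diagram `g` of size `n - 1`, applied at some chord `{u, g u}` of `g`
and some arc position `p` of `g`. -/
theorem prime_is_teepee_of_smaller_prime (n : ℕ) (hn : 3 ≤ n)
    (f : ZMod (2 * n) → ZMod (2 * n))
    (hinv : Function.Involutive f) (hfpf : ∀ i, f i ≠ i)
    (hprime : (interlacementGraph f).Connected)
    (hparity : FirstParity f)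
    (hwheel : ¬ ∀ i : ZMod (2 * n), f i = i + (n : ZMod (2 * n))) :
    ∃ (g : ZMod (2 * (n - 1)) → ZMod (2 * (n - 1))) (u p : ZMod (2 * (n - 1)))
      (swap : Bool) (r : ZMod (2 * n)),
        Function.Involutive g ∧ (∀ i, g i ≠ i) ∧ (interlacementGraph g).Connected ∧
        FirstParity (teepee n g u p swap) ∧
        (∀ x : ZMod (2 * n), f x = teepee n g u p swap (x - r) + r) := by
  have i1 : NeZero (2 * n) := ⟨by omega⟩
  have i2 : NeZero (2 * (n - 1)) := ⟨by omega⟩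
  have hpar := (firstParity_iff f hinv hfpf).1 hparity
  have hlin := linPrime_of_connected f hinv hfpf hprime
  obtain ⟨x, hx⟩ : ∃ x, ¬ BadZ f x := by
    by_contra hh
    push Not at hh
    exact hwheel (wheel_of_bad n hn f hinv hpar hlin hh)
  obtain ⟨r, rfl⟩ : ∃ r, x = r + 1 := ⟨x - 1, by ring⟩
  let h : ZMod (2 * n) → ZMod (2 * n) := fun y => f (y + r) - r
  have hinv' : Function.Involutive h := by
    intro y
    simp only [h, sub_add_cancel, hinv (y + r), add_sub_cancel_right]
  have hfpf' : ∀ y, h y ≠ y := by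
    intro y e
    exact hfpf (y + r) (sub_eq_iff_eq_add.1 e)
  have hp' : LinPrime h 0 := by
    intro s t h1 h2 h3
    obtain ⟨i, j1, j2, j3⟩ := hlin r s t h1 h2 h3
    refine ⟨i - r, by rwa [sub_zero], by rwa [sub_zero], ?_⟩
    simpa only [h, sub_add_cancel, sub_zero] using j3
  have hb' : ¬ BadZ h 1 := by
    rintro ⟨s, t, h1, h2, h3, h4, h5, h6, h7, h8, h9⟩
    have e1 : ∀ y, h y - 1 = f (y + r) - (r + 1) := by
      intro y; simp only [h]; ring
    have e2 : (1 : ZMod (2 * n)) + r = r + 1 := by ring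
    have e3 : (1 : ZMod (2 * n)) + 1 + r = r + 1 + 1 := by ring
    rw [e1, e2] at h5 h6
    rw [e1, e3] at h7 h8
    refine hx ⟨s, t, h1, h2, h3, h4, h5, h6, h7, h8, ?_⟩
    intro i k1 k2 k3 k4
    have e4 : i - r - 1 = i - (r + 1) := by ring
    have := h9 (i - r) (by rwa [e4]) (by rwa [e4]) ?_ ?_
    · rwa [e1, sub_add_cancel] at this
    · intro e
      simp only [h, sub_add_cancel] at e
      exact k3 (by rw [sub_eq_iff_eq_add.1 e]; ring)
    · intro e
      simp only [h, sub_add_cancel] at e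
      exact k4 (by rw [sub_eq_iff_eq_add.1 e]; ring)
  obtain ⟨g, u, g1, g2, g3, g4⟩ := unteepee n hn h hinv' hfpf' hp' hb'
  have ht : teepee n g u 0 false = h := funext g4
  refine ⟨g, u, 0, false, r, g1, g2,
    connected_of_linPrime (by omega) g g1 g2 0 g3, ?_, ?_⟩
  · rw [ht, firstParity_iff h hinv' hfpf']
    intro y
    have e : h y - y = f (y + r) - (y + r) := by simp only [h]; ring
    rw [e]
    exact hpar _
  · intro x
    rw [ht]
    simp only [h, sub_add_cancel]
end

section
/- Let n be a positive integer and let R be a set of pairs (i,j) with 1 ≤ i < j ≤ n. Then R is the inversion set of some permutation, i.e. there exists a permutation π of {1,…,n} with R = {(i,j) : i < j and π(i) > π(j)}, if and only if the following two conditions hold: (1) if (i,j) ∈ R and (j,k) ∈ R then (i,k) ∈ R; and (2) if (i,k) ∈ R then for every j with i < j < k, (i,j) ∈ R or (j,k) ∈ R. -/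
/-- A set `R` of pairs `(i, j)` with `i < j` in `{1, …, n}` is the inversion
set of some permutation `π` (i.e. `R = {(i,j) : i < j ∧ π i > π j}`) iff (1) `R` is
"transitive": `(i,j) ∈ R` and `(j,k) ∈ R` imply `(i,k) ∈ R`, and (2) whenever `(i,k) ∈ R`,
for every `j` with `i < j < k`, `(i,j) ∈ R` or `(j,k) ∈ R`. -/
theorem inversion_set_characterization (n : ℕ) (hn : 0 < n)
    (R : Set (Fin n × Fin n)) (hR : ∀ p ∈ R, p.1 < p.2) :
    (∃ π : Equiv.Perm (Fin n),
        R = {p : Fin n × Fin n | p.1 < p.2 ∧ π p.2 < π p.1}) ↔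
      ((∀ i j k : Fin n, (i, j) ∈ R → (j, k) ∈ R → (i, k) ∈ R) ∧
        (∀ i k : Fin n, (i, k) ∈ R → ∀ j : Fin n, i < j → j < k →
          (i, j) ∈ R ∨ (j, k) ∈ R)) := by
  classical
  constructor
  · rintro ⟨π, rfl⟩
    simp only [Set.mem_ofPred_eq]
    refine ⟨fun i j k h1 h2 => ⟨h1.1.trans h2.1, h2.2.trans h1.2⟩, ?_⟩
    intro i k h j hij hjk
    rcases lt_or_ge (π j) (π i) with h' | h'
    · exact Or.inl ⟨hij, h'⟩
    · exact Or.inr ⟨hjk, h.2.trans_le h'⟩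
  · rintro ⟨h1, h2⟩
    have hR' : ∀ a b, (a, b) ∈ R → a < b := fun a b h => hR (a, b) h
    -- the total order that `π` has to induce
    obtain ⟨L, hL⟩ : ∃ L : Fin n → Fin n → Prop,
        ∀ a b, L a b ↔ (a < b ∧ (a, b) ∉ R) ∨ (b, a) ∈ R := ⟨_, fun _ _ => Iff.rfl⟩
    have irr : ∀ a, ¬ L a a := by
      intro a h
      rcases (hL a a).1 h with h | h
      · exact lt_irrefl _ h.1
      · exact lt_irrefl _ (hR' _ _ h)
    have tot : ∀ a b, a ≠ b → L a b ∨ L b a := by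
      intro a b hab
      simp only [hL]
      rcases lt_or_gt_of_ne hab with h | h <;> tauto
    have tr : ∀ a b c, L a b → L b c → L a c := by
      intro a b c hab hbc
      rw [hL] at hab hbc ⊢
      rcases hab with ⟨ab, nab⟩ | ba <;> rcases hbc with ⟨bc, nbc⟩ | cb
      · exact Or.inl ⟨ab.trans bc, fun h => (h2 a c h b ab bc).elim nab nbc⟩
      · have := hR' _ _ cb
        rcases lt_trichotomy a c with h | h | h
        · exact Or.inl ⟨h, fun h' => nab (h1 _ _ _ h' cb)⟩
        · exact absurd (h ▸ cb) nab
        · exact Or.inr ((h2 c b cb a h ab).resolve_right nab)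
      · have := hR' _ _ ba
        rcases lt_trichotomy a c with h | h | h
        · exact Or.inl ⟨h, fun h' => nbc (h1 _ _ _ ba h')⟩
        · exact absurd (h ▸ ba) nbc
        · exact Or.inr ((h2 b a ba c bc h).resolve_left nbc)
      · exact Or.inr (h1 _ _ _ cb ba)
    let f : Fin n → Fin n := fun a => ⟨(Finset.univ.filter (fun x => L x a)).card, by
      have : (Finset.univ.filter (fun x => L x a)).card < (Finset.univ : Finset (Fin n)).card := by
        apply Finset.card_lt_card
        rw [Finset.filter_ssubset]
        exact ⟨a, Finset.mem_univ _, irr a⟩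
      simpa using this⟩
    have mono : ∀ a b, L a b → f a < f b := by
      intro a b hab
      change (Finset.univ.filter (fun x => L x a)).card < (Finset.univ.filter (fun x => L x b)).card
      apply Finset.card_lt_card
      rw [Finset.ssubset_iff_of_subset]
      · exact ⟨a, by simpa using hab, by simpa using irr a⟩
      · intro x hx
        simp only [Finset.mem_filter, Finset.mem_univ, true_and] at hx ⊢
        exact tr _ _ _ hx hab
    have inj : Function.Injective f := by
      intro a b hab
      by_contra hne
      rcases tot a b hne with h | h
      · exact (mono _ _ h).ne hab
      · exact (mono _ _ h).ne hab.symm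
    refine ⟨Equiv.ofBijective f (Finite.injective_iff_bijective.1 inj), ?_⟩
    ext ⟨a, b⟩
    simp only [Set.mem_ofPred_eq, Equiv.ofBijective_apply]
    constructor
    · intro h
      exact ⟨hR' _ _ h, mono _ _ ((hL _ _).2 (Or.inr h))⟩
    · rintro ⟨hab, h⟩
      by_contra hn'
      exact lt_asymm h (mono _ _ ((hL _ _).2 (Or.inl ⟨hab, hn'⟩)))
end

section
/- Let G be a finite simple graph on vertex set {0,1,…,n} (n ≥ 1) with adjacency matrix M = (m_{i,j}) over GF(2) (indices 0 ≤ i,j ≤ n), and suppose: (a) vertex 0 is adjacent to every other vertex; (b) every vertex of G has even degree; (c) any two non-adjacent vertices have an even number of common neighbours (for all i ≠ j, m_{i,j} = 0 implies ⟨m_i,m_j⟩ = 0); and (d) for every cycle of G with edges c_1,…,c_ℓ, Σ_{i=1}^{ℓ} ω(c_i) ≡ ℓ (mod 2), where ω({i,j}) = ⟨m_i,m_j⟩. Then M is idempotent: M² = M over GF(2). -/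
/-- Let `G` be a finite simple graph on `{0, 1, …, n}` (`n ≥ 1`) with
adjacency matrix `M` over `GF(2)` such that: (a) vertex `0` is adjacent to every other
vertex; (b) every vertex has even degree; (c) any two distinct non-adjacent vertices have
an even number of common neighbours; (d) for every cycle with edges `c_1, …, c_ℓ`,
`∑ ω(c_i) ≡ ℓ (mod 2)` where `ω({i,j}) = ⟨m_i, m_j⟩ = (M*M) i j`. Then `M` is idempotent. -/
theorem meander_graph_adjMatrix_idempotent (n : ℕ) (hn : 1 ≤ n)
    (G : SimpleGraph (Fin (n + 1))) [DecidableRel G.Adj]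
    (ha : ∀ v : Fin (n + 1), v ≠ 0 → G.Adj 0 v)
    (hb : ∀ v : Fin (n + 1), Even (G.degree v))
    (hc : ∀ i j : Fin (n + 1), i ≠ j → G.adjMatrix (ZMod 2) i j = 0 →
      (G.adjMatrix (ZMod 2) * G.adjMatrix (ZMod 2)) i j = 0)
    (hd : ∀ (v : Fin (n + 1)) (w : G.Walk v v), w.IsCycle →
      (w.darts.map (fun d =>
          (G.adjMatrix (ZMod 2) * G.adjMatrix (ZMod 2)) d.fst d.snd)).sum
        = (w.length : ZMod 2)) :
    G.adjMatrix (ZMod 2) * G.adjMatrix (ZMod 2) = G.adjMatrix (ZMod 2) := by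
  have diag : ∀ i, (G.adjMatrix (ZMod 2) * G.adjMatrix (ZMod 2)) i i = 0 := by
    intro i
    rw [SimpleGraph.adjMatrix_mul_self_apply_self]
    exact (ZMod.natCast_eq_zero_iff_even).2 (hb i)
  have symm : ∀ i j, (G.adjMatrix (ZMod 2) * G.adjMatrix (ZMod 2)) i j
      = (G.adjMatrix (ZMod 2) * G.adjMatrix (ZMod 2)) j i := by
    intro i j
    simp only [Matrix.mul_apply]
    refine Finset.sum_congr rfl fun k _ => ?_
    simp only [SimpleGraph.adjMatrix_apply, G.adj_comm i k, G.adj_comm k j]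
    ring
  have zero : ∀ i, i ≠ 0 → (G.adjMatrix (ZMod 2) * G.adjMatrix (ZMod 2)) 0 i = 1 := by
    intro i hi
    have h1 := diag i
    rw [Matrix.mul_apply, Fin.sum_univ_succ] at h1 ⊢
    have h2 : ∀ k : Fin n, G.adjMatrix (ZMod 2) 0 k.succ * G.adjMatrix (ZMod 2) k.succ i
        = G.adjMatrix (ZMod 2) i k.succ * G.adjMatrix (ZMod 2) k.succ i := by
      intro k
      have h3 := ha k.succ (Fin.succ_ne_zero k)
      by_cases h : G.Adj i k.succ <;>
        simp [SimpleGraph.adjMatrix_apply, h3, h, G.adj_comm k.succ i]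
    rw [Finset.sum_congr rfl fun k _ => h2 k]
    have h4 := ha i hi
    simp only [SimpleGraph.adjMatrix_apply, h4, h4.symm, G.irrefl, if_true, if_false,
      mul_one, zero_add] at h1 ⊢
    generalize (∑ k : Fin n, _ : ZMod 2) = s at h1 ⊢
    revert s
    decide
  ext i j
  by_cases hij : i = j
  · subst hij
    rw [diag]; simp
  by_cases hadj : G.Adj i j
  · have hM : G.adjMatrix (ZMod 2) i j = 1 := by simp [hadj]
    rw [hM]
    by_cases hi : i = 0
    · subst hi
      exact zero j (Ne.symm hij)
    by_cases hj : j = 0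
    · subst hj
      rw [symm]
      exact zero i hi
    have hcyc := hd 0 (.cons (ha i hi) (.cons hadj (.cons (ha j hj).symm .nil))) (by
      simp [SimpleGraph.Walk.cons_isCycle_iff, hi, hj, hij, Ne.symm hi, Ne.symm hj])
    simp only [SimpleGraph.Walk.darts_cons, SimpleGraph.Walk.darts_nil, List.map_cons,
      List.map_nil, List.sum_cons, List.sum_nil, SimpleGraph.Walk.length_cons,
      SimpleGraph.Walk.length_nil] at hcyc
    rw [zero i hi, symm j 0, zero j hj] at hcyc
    generalize (G.adjMatrix (ZMod 2) * G.adjMatrix (ZMod 2)) i j = s at hcyc ⊢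
    revert s
    decide
  · have hM : G.adjMatrix (ZMod 2) i j = 0 := by simp [hadj]
    rw [hM]
    exact hc i j hij hM
end

section
/- Let f be the chord diagram of size 9 on ZMod 18 given by the nine chords {0,5}, {1,8}, {2,9}, {3,14}, {4,15}, {6,13}, {7,12}, {10,17}, {11,16} (f is the involution swapping the two elements of each pair), and let G be its interlacement graph with adjacency matrix M over GF(2). Then: (1) every vertex of G has even degree (PC1); (2) every pair of non-adjacent vertices of G has an even number of common neighbours (PC2); (3) for any three pairwise adjacent vertices a, b, c of G, the number of vertices adjacent to a but adjacent to neither b nor c, plus the number of vertices adjacent to both b and c but not to a, is even (PC3); yet (4) there is no diagonal matrix Λ over GF(2) such that (M+Λ)² = M+Λ, i.e. the STZ realizability condition fails. Hence conditions PC1, PC2, PC3 together do not imply realizability. -/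
/-- The endpoints of the nine chords `{0,5}, {1,8}, {2,9}, {3,14}, {4,15}, {6,13}, {7,12},
{10,17}, {11,16}` of the size-9 chord diagram on `ZMod 18` (the minimal counterexample). -/
def chordEnds : Fin 9 → ZMod 18 × ZMod 18 :=
  ![(0, 5), (1, 8), (2, 9), (3, 14), (4, 15), (6, 13), (7, 12), (10, 17), (11, 16)]

/-- `b` lies strictly between `a` and `c` in the cyclic order of `ZMod 18`. -/
def sb (a c b : ZMod 18) : Prop :=
  0 < (b - a).val ∧ (b - a).val < (c - a).val

instance (a c b : ZMod 18) : Decidable (sb a c b) := by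
  unfold sb; infer_instance

/-- Chords `k` and `l` interlace: exactly one endpoint of chord `l` lies strictly between
the endpoints of chord `k` in the cyclic order of `ZMod 18`. -/
def chordInterlace (k l : Fin 9) : Prop :=
  (sb (chordEnds k).1 (chordEnds k).2 (chordEnds l).1 ∧
      ¬ sb (chordEnds k).1 (chordEnds k).2 (chordEnds l).2) ∨
    (¬ sb (chordEnds k).1 (chordEnds k).2 (chordEnds l).1 ∧
      sb (chordEnds k).1 (chordEnds k).2 (chordEnds l).2)

instance (k l : Fin 9) : Decidable (chordInterlace k l) := by
  unfold chordInterlace; infer_instance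

/-- The interlacement graph of the counterexample chord diagram: vertices are the nine
chords, with an edge between two chords whenever they interlace. -/
def counterG : SimpleGraph (Fin 9) := SimpleGraph.fromRel chordInterlace

instance : DecidableRel counterG.Adj := fun a b =>
  decidable_of_iff _ (SimpleGraph.fromRel_adj chordInterlace a b).symm

/-- The adjacency matrix over `GF(2)` of the interlacement graph `counterG`. -/
def counterM : Matrix (Fin 9) (Fin 9) (ZMod 2) := counterG.adjMatrix (ZMod 2)

/-- The interlacement graph `G` (with adjacency matrix `M` over `GF(2)`)
of the size-9 chord diagram with chords `{0,5}, {1,8}, {2,9}, {3,14}, {4,15}, {6,13},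
{7,12}, {10,17}, {11,16}` satisfies: (1) every vertex has even degree (PC1); (2) every pair
of distinct non-adjacent vertices has an even number of common neighbours (PC2); (3) for
any three pairwise adjacent vertices `a, b, c`, the number of (other) vertices adjacent to
`a` but to neither `b` nor `c`, plus the number of (other) vertices adjacent to both `b`
and `c` but not to `a`, is even (PC3); yet (4) there is no diagonal matrix `Λ` over `GF(2)`
with `M + Λ` idempotent, i.e. the STZ realizability condition fails. Hence PC1, PC2, PC3
together do not imply realizability. -/
theorem counterexample_size9 :
    (∀ v : Fin 9, Even (counterG.degree v)) ∧
    (∀ u v : Fin 9, u ≠ v → ¬ counterG.Adj u v →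
      Even ((counterG.neighborFinset u ∩ counterG.neighborFinset v).card)) ∧
    (∀ a b c : Fin 9, counterG.Adj a b → counterG.Adj a c → counterG.Adj b c →
      Even ((Finset.univ.filter (fun x => x ≠ a ∧ x ≠ b ∧ x ≠ c ∧
            counterG.Adj a x ∧ ¬ counterG.Adj b x ∧ ¬ counterG.Adj c x)).card +
        (Finset.univ.filter (fun x => x ≠ a ∧ x ≠ b ∧ x ≠ c ∧
            counterG.Adj b x ∧ counterG.Adj c x ∧ ¬ counterG.Adj a x)).card)) ∧
    (¬ ∃ d : Fin 9 → ZMod 2,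
      (counterM + Matrix.diagonal d) * (counterM + Matrix.diagonal d)
        = counterM + Matrix.diagonal d) := by
  refine ⟨by decide +kernel, by decide +kernel, by decide +kernel, ?_⟩
  -- entries of the idempotency equation along the 4-cycle 1, 3, 7, 5 are inconsistent
  rintro ⟨d, hd⟩
  have key : ∀ u v : Fin 9, u ≠ v →
      (counterM * counterM) u v + d u * counterM u v + counterM u v * d v = counterM u v := by
    intro u v huv
    have h := congrFun (congrFun hd u) v
    simpa [add_mul, mul_add, Matrix.diagonal_apply_ne _ huv, ← add_assoc, Matrix.add_apply,
      Matrix.mul_diagonal, Matrix.diagonal_mul] using h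
  have e : counterM 1 3 = 1 ∧ counterM 3 7 = 1 ∧ counterM 7 5 = 1 ∧ counterM 5 1 = 1 := by
    decide +kernel
  have q : (counterM * counterM) 1 3 = 1 ∧ (counterM * counterM) 3 7 = 1 ∧
      (counterM * counterM) 7 5 = 0 ∧ (counterM * counterM) 5 1 = 1 := by
    decide +kernel
  obtain ⟨e1, e2, e3, e4⟩ := e
  obtain ⟨q1, q2, q3, q4⟩ := q
  have h1 := key 1 3 (by decide)
  have h2 := key 3 7 (by decide)
  have h3 := key 7 5 (by decide)
  have h4 := key 5 1 (by decide)
  rw [e1, q1] at h1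
  rw [e2, q2] at h2
  rw [e3, q3] at h3
  rw [e4, q4] at h4
  generalize d 1 = a at *
  generalize d 3 = b at *
  generalize d 7 = c at *
  generalize d 5 = z at *
  clear key hd
  revert a b c z
  decide +kernel
end
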